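/- For every ε > 0 there exist constants c_ε > 0 and c > 0 such that the following holds. Let p be a prime with p ≡ 3 (mod 4) and let E ⊆ F_p² with |E| ≤ c·p^{1558/1489}. Then |Δ(E)| ≥ c_ε·p^{−ε}·|E|^{424/779}. -/

import Mathlib

open Finset

namespace FpDist

/-- Points of `𝔽_p²`. -/
abbrev Pt (p : ℕ) := ZMod p × ZMod p

/-- The "distance" `‖x - y‖ = (x₁-y₁)² + (x₂-y₂)²` in `𝔽_p²`. -/
def dist2 {p : ℕ} (x y : Pt p) : ZMod p := (x.1 - y.1)^2 + (x.2 - y.2)^2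

/-- `‖x‖ = x₁² + x₂²`. -/
def norm2 {p : ℕ} (x : Pt p) : ZMod p := x.1^2 + x.2^2

/-- The distance set `Δ(E) = {‖x - y‖ : x, y ∈ E}`. -/
def distSet {p : ℕ} (E : Finset (Pt p)) : Finset (ZMod p) :=
  (E ×ˢ E).image fun q => dist2 q.1 q.2

/-- `(a, b, c)` is a corner if `(b - a) · (c - a) = 0`. -/
def IsCorner {p : ℕ} (a b c : Pt p) : Prop :=
  (b.1 - a.1) * (c.1 - a.1) + (b.2 - a.2) * (c.2 - a.2) = 0

/-- `(a, b, c, d)` forms a rectangle if `(a,b,d), (b,a,c), (c,b,d), (d,a,c)` are corners. -/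
def IsRectangle {p : ℕ} (a b c d : Pt p) : Prop :=
  IsCorner a b d ∧ IsCorner b a c ∧ IsCorner c b d ∧ IsCorner d a c

/-- `□(E)`: the number of non-degenerate rectangles `(a,b,c,d) ∈ E⁴`
(non-degenerate: not all four vertices lie on one line). -/
noncomputable def rectCount (p : ℕ) [Fact p.Prime] (E : Finset (Pt p)) : ℕ :=
  Set.ncard {q : Pt p × Pt p × Pt p × Pt p |
    q.1 ∈ E ∧ q.2.1 ∈ E ∧ q.2.2.1 ∈ E ∧ q.2.2.2 ∈ E ∧
    IsRectangle q.1 q.2.1 q.2.2.1 q.2.2.2 ∧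
    ¬ Collinear (ZMod p) ({q.1, q.2.1, q.2.2.1, q.2.2.2} : Set (Pt p))}

/-- `T(E)`: the number of isosceles triangles, i.e. triples `(a,b,c) ∈ E³`
with `‖a - c‖ = ‖b - c‖ ≠ 0`. -/
def triCount {p : ℕ} (E : Finset (Pt p)) : ℕ :=
  ((E ×ˢ E ×ˢ E).filter fun q =>
    dist2 q.1 q.2.2 = dist2 q.2.1 q.2.2 ∧ dist2 q.1 q.2.2 ≠ 0).card

section Elimination

variable {K : Type*} [Field K]

open Polynomial in
/-- The Sylvester determinant of two polynomials with multivariate coefficients has small degree. -/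
theorem totalDegree_resultant_le {n : ℕ} (F G : Polynomial (MvPolynomial (Fin n) K)) {a b : ℕ}
    (hF : ∀ i, (F.coeff i).totalDegree ≤ a) (hG : ∀ i, (G.coeff i).totalDegree ≤ b) (k l : ℕ) :
    (F.resultant G k l).totalDegree ≤ k * b + l * a := by
  classical
  unfold Polynomial.resultant
  rw [Matrix.det_apply]
  refine MvPolynomial.totalDegree_finsetSum_le fun σ _ => ?_
  have h1 : ((∏ i, F.sylvester G k l (σ i) i)).totalDegree ≤ k * b + l * a := by
    refine (MvPolynomial.totalDegree_finsetProd _ _).trans ?_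
    rw [Fin.sum_univ_add]
    refine add_le_add ?_ ?_
    · refine (Finset.sum_le_card_nsmul _ _ b fun i _ => ?_).trans (by simp)
      simp only [Polynomial.sylvester, Matrix.of_apply, Fin.addCases_left]
      split_ifs
      · exact hG _
      · simp
    · refine (Finset.sum_le_card_nsmul _ _ a fun i _ => ?_).trans (by simp)
      simp only [Polynomial.sylvester, Matrix.of_apply, Fin.addCases_right]
      split_ifs
      · exact hF _
      · simp
  rcases Int.units_eq_one_or (Equiv.Perm.sign σ) with h | h
  · simpa [h] using h1
  · simpa [h] using h1

theorem totalDegree_coeff_finSuccEquiv_le {n : ℕ} (f : MvPolynomial (Fin (n + 1)) K) (i : ℕ) :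
    ((MvPolynomial.finSuccEquiv K n f).coeff i).totalDegree ≤ f.totalDegree := by
  by_cases h : (MvPolynomial.finSuccEquiv K n f).coeff i = 0
  · simp [h]
  · exact (Nat.le_add_right _ _).trans (MvPolynomial.totalDegree_coeff_finSuccEquiv_add_le f i h)

theorem natDegree_finSuccEquiv_le {n : ℕ} (f : MvPolynomial (Fin (n + 1)) K) :
    (MvPolynomial.finSuccEquiv K n f).natDegree ≤ f.totalDegree := by
  by_cases h : f = 0
  · simp [h]
  · refine (Nat.le_add_left _ _).trans (MvPolynomial.totalDegree_coeff_finSuccEquiv_add_le f _ ?_)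
    simpa using h

theorem eval_eq_eval_finSuccEquiv {n : ℕ} (f : MvPolynomial (Fin (n + 1)) K) (x : Fin (n + 1) → K) :
    MvPolynomial.eval x f = Polynomial.eval (x 0)
      ((MvPolynomial.finSuccEquiv K n f).map (MvPolynomial.eval (Fin.tail x))) := by
  rw [← MvPolynomial.eval_eq_eval_mv_eval']
  congr 2
  exact (Fin.cons_self_tail x).symm

/-- Eliminating one variable from a pair of polynomials, the first of which is irreducible and does
not divide the second. -/
theorem exists_eliminant {n : ℕ} {f g : MvPolynomial (Fin (n + 1)) K} (hf : Irreducible f)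
    (hfg : ¬ f ∣ g) :
    ∃ R : MvPolynomial (Fin n) K, R ≠ 0 ∧
      R.totalDegree ≤ f.totalDegree * (2 * g.totalDegree + 1) ∧
      ∀ x : Fin (n + 1) → K, MvPolynomial.eval x f = 0 → MvPolynomial.eval x g = 0 →
        MvPolynomial.eval (Fin.tail x) R = 0 := by
  set F := MvPolynomial.finSuccEquiv K n f with hF
  set G := MvPolynomial.finSuccEquiv K n g with hG
  have hFirr : Irreducible F := (MulEquiv.irreducible_iff (MvPolynomial.finSuccEquiv K n)).2 hf
  have hFG : ¬ F ∣ G := fun h => hfg ((map_dvd_iff (MvPolynomial.finSuccEquiv K n)).1 h)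
  by_cases h0 : F.natDegree = 0
  · obtain ⟨r, hr⟩ := Polynomial.natDegree_eq_zero.1 h0
    refine ⟨r, ?_, ?_, fun x hx _ => ?_⟩
    · rintro rfl
      exact hFirr.ne_zero (by simpa using hr.symm)
    · have h1 := totalDegree_coeff_finSuccEquiv_le f 0
      rw [← hF, ← hr, Polynomial.coeff_C_zero] at h1
      nlinarith
    · rw [eval_eq_eval_finSuccEquiv, ← hF, ← hr] at hx
      simpa using hx
  · refine ⟨F.resultant G, ?_, ?_, fun x hx hx' => ?_⟩
    · let Q := FractionRing (MvPolynomial (Fin n) K)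
      have hprim : F.IsPrimitive := hFirr.isPrimitive h0
      have hQirr : Irreducible (F.map (algebraMap _ Q)) :=
        (hprim.irreducible_iff_irreducible_map_fraction_map).1 hFirr
      have hinj : Function.Injective (algebraMap (MvPolynomial (Fin n) K) Q) :=
        IsFractionRing.injective _ _
      have hnd : ¬ F.map (algebraMap _ Q) ∣ G.map (algebraMap _ Q) := fun h =>
        hFG (hprim.dvd_of_fraction_map_dvd_fraction_map h)
      have hcop := (hQirr.coprime_iff_not_dvd).2 hnd
      intro hzero
      have h2 : (F.map (algebraMap _ Q)).resultant (G.map (algebraMap _ Q)) = 0 := by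
        rw [Polynomial.natDegree_map_eq_of_injective hinj,
          Polynomial.natDegree_map_eq_of_injective hinj, Polynomial.resultant_map_map, hzero,
          map_zero]
      exact (Polynomial.resultant_eq_zero_iff.1 h2).2 hcop
    · refine (totalDegree_resultant_le F G (totalDegree_coeff_finSuccEquiv_le f)
        (totalDegree_coeff_finSuccEquiv_le g) _ _).trans ?_
      have h1 := natDegree_finSuccEquiv_le f
      have h2 := natDegree_finSuccEquiv_le g
      rw [← hF] at h1
      rw [← hG] at h2
      nlinarith [Nat.mul_le_mul_right g.totalDegree h1, Nat.mul_le_mul_right f.totalDegree h2]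
    · obtain ⟨p, q, -, -, h⟩ := Polynomial.exists_mul_add_mul_eq_C_resultant F G le_rfl le_rfl
        (Or.inl h0)
      have h1 := congrArg (fun P => Polynomial.eval (x 0)
        (P.map (MvPolynomial.eval (Fin.tail x)))) h
      rw [eval_eq_eval_finSuccEquiv, ← hF] at hx
      rw [eval_eq_eval_finSuccEquiv, ← hG] at hx'
      simpa [hx, hx'] using h1.symm

/-- A nonzero plane polynomial vanishes on at most `totalDegree` lines of the form
`y = b - s * x`. -/
theorem card_lines_le_totalDegree [Infinite K] {R : MvPolynomial (Fin 2) K} (hR : R ≠ 0)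
    (T : Finset (K × K))
    (hT : ∀ τ ∈ T, ∀ t, MvPolynomial.eval ![τ.2 - τ.1 * t, t] R = 0) :
    T.card ≤ R.totalDegree := by
  classical
  set F := MvPolynomial.finSuccEquiv K 1 R with hF
  have hF0 : F ≠ 0 := by simpa [hF] using hR
  have hlc : F.leadingCoeff ≠ 0 := Polynomial.leadingCoeff_ne_zero.2 hF0
  have hbad : ∃ t : K, MvPolynomial.eval ![t] F.leadingCoeff ≠ 0 ∧
      ∀ τ ∈ T, ∀ τ' ∈ T, τ ≠ τ' → τ.2 - τ.1 * t ≠ τ'.2 - τ'.1 * t := by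
    let P : MvPolynomial (Fin 1) K := F.leadingCoeff * ∏ q ∈ (T ×ˢ T).filter (fun q => q.1 ≠ q.2),
      (MvPolynomial.C (q.1.2 - q.2.2) - MvPolynomial.C (q.1.1 - q.2.1) * MvPolynomial.X 0)
    have hP : P ≠ 0 := by
      refine mul_ne_zero hlc (Finset.prod_ne_zero_iff.2 fun q hq h0 => (Finset.mem_filter.1 hq).2 ?_)
      have h1 : ∀ t : K, (q.1.2 - q.2.2) - (q.1.1 - q.2.1) * t = 0 := fun t => by
        simpa using congrArg (MvPolynomial.eval ![t]) h0
      have h2 := h1 0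
      have h3 := h1 1
      exact Prod.ext (by linear_combination h2 - h3) (by linear_combination h2)
    obtain ⟨v, hv⟩ : ∃ v, MvPolynomial.eval v P ≠ 0 := by
      by_contra! h
      exact hP (MvPolynomial.funext fun v => by simpa using h v)
    have hv' : v = ![v 0] := by ext i; fin_cases i; rfl
    rw [hv', map_mul, map_prod] at hv
    refine ⟨v 0, left_ne_zero_of_mul hv, fun τ hτ τ' hτ' hne he => ?_⟩
    have := Finset.prod_ne_zero_iff.1 (right_ne_zero_of_mul hv) (τ, τ')
      (by simp [hτ, hτ', hne])
    apply this
    simp only [map_sub, map_mul, MvPolynomial.eval_C, MvPolynomial.eval_X, Matrix.cons_val_zero]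
    linear_combination he
  obtain ⟨t, ht, hdist⟩ := hbad
  set Q : Polynomial K := F.map (MvPolynomial.eval ![t]) with hQ
  have hQ0 : Q ≠ 0 := by
    intro h
    apply ht
    simpa [hQ] using congrArg (fun P => Polynomial.coeff P F.natDegree) h
  have hroot : T.image (fun τ => τ.2 - τ.1 * t) ⊆ Q.roots.toFinset := by
    intro y hy
    obtain ⟨τ, hτ, rfl⟩ := Finset.mem_image.1 hy
    have h1 := hT τ hτ t
    rw [eval_eq_eval_finSuccEquiv] at h1
    rw [Multiset.mem_toFinset, Polynomial.mem_roots hQ0]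
    exact h1
  calc T.card = (T.image (fun τ => τ.2 - τ.1 * t)).card := by
        refine (Finset.card_image_of_injOn fun τ hτ τ' hτ' he => ?_).symm
        by_contra hne
        exact hdist τ hτ τ' hτ' hne he
    _ ≤ Q.roots.toFinset.card := Finset.card_le_card hroot
    _ ≤ Q.natDegree := (Multiset.toFinset_card_le _).trans (Polynomial.card_roots' _)
    _ ≤ F.natDegree := Polynomial.natDegree_map_le
    _ ≤ R.totalDegree := natDegree_finSuccEquiv_le R

end Elimination

section NullLines

variable {K : Type*} [Field K]

theorem totalDegree_pderiv_le {σ : Type*} (i : σ) (f : MvPolynomial σ K) :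
    (MvPolynomial.pderiv i f).totalDegree ≤ f.totalDegree - 1 := by
  classical
  refine Finset.sup_le fun m hm => ?_
  have h1 : m + Finsupp.single i 1 ∈ f.support := by
    rw [MvPolynomial.mem_support_iff] at hm ⊢
    rw [MvPolynomial.coeff_pderiv] at hm
    exact left_ne_zero_of_mul hm
  have h2 := MvPolynomial.le_totalDegree h1
  rw [Finsupp.sum_add_index' (by simp) (by simp), Finsupp.sum_single_index rfl] at h2
  omega

theorem not_dvd_pderiv {σ : Type*} {i : σ} {f : MvPolynomial σ K}
    (hf : MvPolynomial.pderiv i f ≠ 0) : ¬ f ∣ MvPolynomial.pderiv i f := by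
  rintro ⟨g, hg⟩
  have hf0 : f ≠ 0 := fun h => hf (by simp [h])
  have hg0 : g ≠ 0 := fun h => hf (by simp [hg, h])
  have h1 := totalDegree_pderiv_le i f
  have h2 := MvPolynomial.totalDegree_mul_of_isDomain hf0 hg0
  rw [← hg] at h2
  have h3 : f.totalDegree = 0 := by omega
  rw [MvPolynomial.totalDegree_eq_zero_iff_eq_C] at h3
  exact hf (by rw [h3]; simp)

theorem natDegree_finSuccEquiv_eq_zero {p : ℕ} [CharP K p] {n : ℕ}
    {f : MvPolynomial (Fin (n + 1)) K} (hp : f.totalDegree < p)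
    (hf : MvPolynomial.pderiv 0 f = 0) : (MvPolynomial.finSuccEquiv K n f).natDegree = 0 := by
  classical
  by_contra h0
  set k := (MvPolynomial.finSuccEquiv K n f).natDegree with hk
  obtain ⟨j, hj⟩ : ∃ j, k = j + 1 := ⟨k - 1, by omega⟩
  have hkp : k < p := (natDegree_finSuccEquiv_le f).trans_lt hp
  have hlc : (MvPolynomial.finSuccEquiv K n f).coeff k ≠ 0 := by
    rw [hk, Polynomial.coeff_natDegree, Polynomial.leadingCoeff_ne_zero]
    intro h
    simp [hk, h] at h0
  obtain ⟨m, hm⟩ := MvPolynomial.ne_zero_iff.1 hlc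
  rw [MvPolynomial.finSuccEquiv_coeff_coeff] at hm
  have h1 := MvPolynomial.coeff_pderiv (i := 0) f (Finsupp.cons j m)
  rw [hf, MvPolynomial.coeff_zero] at h1
  have h2 : Finsupp.cons j m + Finsupp.single 0 1 = Finsupp.cons k m := by
    ext i
    refine Fin.cases ?_ (fun i => ?_) i
    · simp [hj]
    · simp
  rw [h2, Finsupp.cons_zero] at h1
  rcases mul_eq_zero.1 h1.symm with h | h
  · exact hm h
  · have h3 : ((k : ℕ) : K) = 0 := by rw [hj]; exact_mod_cast h
    rw [CharP.cast_eq_zero_iff K p] at h3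
    exact absurd (Nat.le_of_dvd (by omega) h3) (by omega)

/-- A line in `K³` with direction `(s², -s, 1)`; such directions form an isotropic cone. -/
structure NLine (K : Type*) where
  s : K
  b : K
  c : K

namespace NLine

variable (l l' : NLine K)

/-- The point of the line with last coordinate `t`. -/
def pt (t : K) : Fin 3 → K := ![l.c + l.s ^ 2 * t, l.b - l.s * t, t]

/-- The restriction of a polynomial to a line. -/
noncomputable def restrict : MvPolynomial (Fin 3) K →ₐ[K] Polynomial K :=
  MvPolynomial.aeval ![Polynomial.C l.c + Polynomial.C (l.s ^ 2) * Polynomial.X,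
    Polynomial.C l.b - Polynomial.C l.s * Polynomial.X, Polynomial.X]

theorem eval_restrict (t : K) (f : MvPolynomial (Fin 3) K) :
    (l.restrict f).eval t = MvPolynomial.eval (l.pt t) f := by
  have h : ((Polynomial.aeval t).comp l.restrict : MvPolynomial (Fin 3) K →ₐ[K] K) =
      MvPolynomial.aeval (l.pt t) := by
    refine MvPolynomial.algHom_ext fun i => ?_
    fin_cases i <;> simp [restrict, pt]
  have := DFunLike.congr_fun h f
  simpa [MvPolynomial.aeval_eq_eval, Polynomial.aeval_def] using this

theorem natDegree_restrict_le (f : MvPolynomial (Fin 3) K) :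
    (l.restrict f).natDegree ≤ f.totalDegree := by
  have h := MvPolynomial.aeval_natDegree_le f le_rfl
    ![Polynomial.C l.c + Polynomial.C (l.s ^ 2) * Polynomial.X,
      Polynomial.C l.b - Polynomial.C l.s * Polynomial.X, Polynomial.X] (n := 1) (fun i => by
      fin_cases i
      · simp only [Fin.zero_eta, Matrix.cons_val_zero]; compute_degree
      · simp only [Fin.mk_one, Matrix.cons_val_one, Matrix.cons_val_zero]; compute_degree
      · simp)
  simpa [restrict] using h

theorem derivative_restrict (f : MvPolynomial (Fin 3) K) :
    Polynomial.derivative (l.restrict f) = l.restrict (MvPolynomial.pderiv 2 f -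
      MvPolynomial.C l.s * MvPolynomial.pderiv 1 f +
      MvPolynomial.C (l.s ^ 2) * MvPolynomial.pderiv 0 f) := by
  induction f using MvPolynomial.induction_on with
  | C a => simp [restrict]
  | add f g hf hg => simp only [map_add, hf, hg]; simp only [map_add, map_sub, map_mul]; ring
  | mul_X f i hf =>
    rw [map_mul, Polynomial.derivative_mul, hf]
    simp only [map_add, map_sub, map_mul, MvPolynomial.pderiv_mul]
    fin_cases i <;>
      simp [restrict, MvPolynomial.pderiv_X, Polynomial.derivative_pow] <;> ring

/-- The polar form of the lines; for distinct slopes it vanishes iff the lines meet. -/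
def form : K := (l.c - l'.c) + (l.s + l'.s) * (l.b - l'.b)

theorem form_swap : l'.form l = - l.form l' := by
  simp only [form]; ring

variable {l l'}

theorem pt_eq_pt (hs : l.s ≠ l'.s) (h : l.form l' = 0) :
    l.pt ((l.b - l'.b) / (l.s - l'.s)) = l'.pt ((l.b - l'.b) / (l.s - l'.s)) := by
  have hs' := sub_ne_zero.2 hs
  simp only [form] at h
  ext i
  fin_cases i
  · simp [pt]; field_simp; linear_combination (l.s - l'.s) * h
  · simp [pt]; field_simp; ring
  · simp [pt]

theorem form_eq_zero_of_pt_eq {t u : K} (h : l.pt t = l'.pt u) : l.form l' = 0 := by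
  have h0 := congrFun h 0
  have h1 := congrFun h 1
  have h2 := congrFun h 2
  simp [pt] at h0 h1 h2
  subst h2
  simp only [form]
  linear_combination h0 + (l.s + l'.s) * h1

/-- A polynomial vanishing at many points of a line vanishes on the line. -/
theorem restrict_eq_zero_of_card (g : MvPolynomial (Fin 3) K) (T : Finset K)
    (hT : ∀ t ∈ T, MvPolynomial.eval (l.pt t) g = 0) (hcard : g.totalDegree < T.card) :
    l.restrict g = 0 := by
  refine Polynomial.eq_zero_of_natDegree_lt_card_of_eval_eq_zero' _ T (fun t ht => ?_)
    ((l.natDegree_restrict_le g).trans_lt hcard)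
  rw [eval_restrict, hT t ht]

/-- The parameters of the meeting points with pairwise disjoint transversals are distinct. -/
theorem injOn_meet (N : Finset (NLine K)) (hN : ∀ w ∈ N, l.s ≠ w.s ∧ l.form w = 0)
    (hskew : ∀ w ∈ N, ∀ w' ∈ N, w ≠ w' → w.form w' ≠ 0) :
    Set.InjOn (fun w : NLine K => (l.b - w.b) / (l.s - w.s)) N := by
  intro w hw w' hw' h
  by_contra hne
  refine hskew w hw w' hw' hne (form_eq_zero_of_pt_eq (t := (l.b - w.b) / (l.s - w.s))
    (u := (l.b - w.b) / (l.s - w.s)) ?_)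
  have h1 := pt_eq_pt (hN w hw).1 (hN w hw).2
  have h2 := pt_eq_pt (hN w' hw').1 (hN w' hw').2
  simp only at h
  rw [← h] at h2
  exact h1.symm.trans h2

theorem restrict_eq_zero_of_meet (g : MvPolynomial (Fin 3) K) (N : Finset (NLine K))
    (hN : ∀ w ∈ N, l.s ≠ w.s ∧ l.form w = 0)
    (hskew : ∀ w ∈ N, ∀ w' ∈ N, w ≠ w' → w.form w' ≠ 0)
    (hg : ∀ w ∈ N, MvPolynomial.eval (l.pt ((l.b - w.b) / (l.s - w.s))) g = 0)
    (hcard : g.totalDegree < N.card) : l.restrict g = 0 := by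
  classical
  refine restrict_eq_zero_of_card g (N.image fun w => (l.b - w.b) / (l.s - w.s)) ?_ ?_
  · simpa using hg
  · rwa [Finset.card_image_of_injOn (injOn_meet N hN hskew)]

end NLine

/-- An irreducible surface shares few isotropic lines with a surface not containing it. -/
theorem card_common_lines_le [Infinite K] {f g : MvPolynomial (Fin 3) K} (hf : Irreducible f)
    (hfg : ¬ f ∣ g) (T : Finset (K × K))
    (hT : ∀ τ ∈ T, ∃ c, (NLine.mk τ.1 τ.2 c).restrict f = 0 ∧
      (NLine.mk τ.1 τ.2 c).restrict g = 0) :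
    T.card ≤ f.totalDegree * (2 * g.totalDegree + 1) := by
  obtain ⟨R, hR0, hRd, hR⟩ := exists_eliminant hf hfg
  refine (card_lines_le_totalDegree hR0 T fun τ hτ t => ?_).trans hRd
  obtain ⟨c, h1, h2⟩ := hT τ hτ
  have h3 := hR ((NLine.mk τ.1 τ.2 c).pt t) (by rw [← NLine.eval_restrict, h1]; simp)
    (by rw [← NLine.eval_restrict, h2]; simp)
  have h4 : Fin.tail ((NLine.mk τ.1 τ.2 c).pt t) = ![τ.2 - τ.1 * t, t] := by
    ext i
    fin_cases i <;> simp [NLine.pt, Fin.tail]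
  rwa [h4] at h3

/-- Uniqueness for a second order linear equation, in characteristic larger than the degree. -/
theorem eq_zero_of_second_order {p : ℕ} [CharP K p] {φ C q r : Polynomial K} {t : K}
    (hp : φ.natDegree < p)
    (hode : C * Polynomial.derivative (Polynomial.derivative φ) =
      q * Polynomial.derivative φ + r * φ)
    (h0 : φ.eval t = 0) (h1 : (Polynomial.derivative φ).eval t = 0) (hC : C.eval t ≠ 0) :
    φ = 0 := by
  classical
  by_contra hφ
  obtain ⟨ψ, hψ, hnd⟩ := φ.exists_eq_pow_rootMultiplicity_mul_and_not_dvd hφ t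
  set m := φ.rootMultiplicity t with hm
  have hψ0 : ψ.eval t ≠ 0 := fun h => hnd (Polynomial.dvd_iff_isRoot.2 h)
  have hmp : m < p := ((Polynomial.count_roots φ).symm.le.trans
    ((Multiset.count_le_card _ _).trans φ.card_roots')).trans_lt hp
  have hcast : ∀ k : ℕ, 0 < k → k < p → (k : K) ≠ 0 := fun k hk hkp h => by
    rw [CharP.cast_eq_zero_iff K p] at h
    exact absurd (Nat.le_of_dvd hk h) (by omega)
  set Y : Polynomial K := Polynomial.X - Polynomial.C t with hY
  have hYt : Y.eval t = 0 := by simp [hY]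
  have hYd : Polynomial.derivative Y = 1 := by simp [hY]
  have hY0 : Y ≠ 0 := Polynomial.X_sub_C_ne_zero t
  rcases m with _ | _ | m
  · rw [hψ] at h0
    simp at h0
    exact hψ0 h0
  · rw [hψ] at h1
    simp [hYt, hYd] at h1
    exact hψ0 h1
  · have e1 : Polynomial.derivative φ = Y ^ (m + 1) * (((m + 2 : ℕ) : Polynomial K) * ψ +
        Y * Polynomial.derivative ψ) := by
      rw [hψ]
      simp only [Polynomial.derivative_mul, Polynomial.derivative_pow, hYd, map_natCast]
      simp only [show m + 1 + 1 - 1 = m + 1 from rfl]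
      push_cast
      ring
    have e2 : Polynomial.derivative (Polynomial.derivative φ) =
        Y ^ m * (((m + 1 : ℕ) : Polynomial K) * ((m + 2 : ℕ) : Polynomial K) * ψ +
          Y * ((2 * m + 4 : ℕ) * Polynomial.derivative ψ +
            Y * Polynomial.derivative (Polynomial.derivative ψ))) := by
      rw [e1]
      simp only [Polynomial.derivative_mul, Polynomial.derivative_pow, hYd, map_natCast,
        Polynomial.derivative_add, Polynomial.derivative_natCast]
      simp only [add_tsub_cancel_right]
      push_cast
      ring
    have e3 : Y ^ m * (C * (((m + 1 : ℕ) : Polynomial K) * ((m + 2 : ℕ) : Polynomial K) * ψ +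
          Y * ((2 * m + 4 : ℕ) * Polynomial.derivative ψ +
            Y * Polynomial.derivative (Polynomial.derivative ψ)))) =
        Y ^ m * (Y * (q * (((m + 2 : ℕ) : Polynomial K) * ψ + Y * Polynomial.derivative ψ)
          + r * Y * ψ)) := by
      rw [e2, e1, hψ] at hode
      linear_combination hode
    have e4 := congrArg (Polynomial.eval t) (mul_left_cancel₀ (pow_ne_zero m hY0) e3)
    simp only [Polynomial.eval_mul, Polynomial.eval_add, hYt, Polynomial.eval_natCast, zero_mul,
      add_zero] at e4
    have c1 := hcast (m + 1) (by omega) (by omega)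
    have c2 := hcast (m + 2) (by omega) (by omega)
    exact mul_ne_zero hC (mul_ne_zero (mul_ne_zero c1 c2) hψ0) e4

end NullLines

section Surfaces

variable {K : Type*} [Field K]

open MvPolynomial in
/-- The coefficients of `1` and `σ` in the remainder of the second fundamental form modulo the
tangency condition `f_x - σ f_y + σ² f_z = 0`, cleared of denominators. -/
noncomputable def asymptoticRemainder (f : MvPolynomial (Fin 3) K) :
    MvPolynomial (Fin 3) K × MvPolynomial (Fin 3) K :=
  let a := pderiv 2 f
  let e := pderiv 1 f
  let c := pderiv 0 f
  let h0 := pderiv 2 a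
  let h1 := -2 * pderiv 2 e
  let h2 := 2 * pderiv 2 c + pderiv 1 e
  let h3 := -2 * pderiv 1 c
  let h4 := pderiv 0 c
  (c ^ 3 * h0 - c ^ 2 * a * h2 - c * a * e * h3 - a * (e ^ 2 - a * c) * h4,
    c ^ 3 * h1 + c ^ 2 * e * h2 + c * (e ^ 2 - a * c) * h3 + (e ^ 3 - 2 * a * c * e) * h4)

open MvPolynomial in
theorem totalDegree_asymptoticRemainder_le (f : MvPolynomial (Fin 3) K) :
    (asymptoticRemainder f).1.totalDegree ≤ 4 * f.totalDegree ∧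
      (asymptoticRemainder f).2.totalDegree ≤ 4 * f.totalDegree := by
  set d := f.totalDegree with hd
  have hadd : ∀ {u v : MvPolynomial (Fin 3) K} {n : ℕ}, u.totalDegree ≤ n → v.totalDegree ≤ n →
      (u + v).totalDegree ≤ n := fun hu hv => (totalDegree_add _ _).trans (max_le hu hv)
  have hsub : ∀ {u v : MvPolynomial (Fin 3) K} {n : ℕ}, u.totalDegree ≤ n → v.totalDegree ≤ n →
      (u - v).totalDegree ≤ n := fun hu hv => (totalDegree_sub _ _).trans (max_le hu hv)
  have hmul : ∀ {u v : MvPolynomial (Fin 3) K} {m n k : ℕ}, u.totalDegree ≤ m →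
      v.totalDegree ≤ n → m + n ≤ k → (u * v).totalDegree ≤ k := fun hu hv h =>
    (totalDegree_mul _ _).trans ((add_le_add hu hv).trans h)
  have htwo : (2 : MvPolynomial (Fin 3) K).totalDegree ≤ 0 := by
    rw [← map_ofNat (C : K →+* MvPolynomial (Fin 3) K) 2, totalDegree_C]
  have hmtwo : (-2 : MvPolynomial (Fin 3) K).totalDegree ≤ 0 := by
    rw [totalDegree_neg]; exact htwo
  have h1 : ∀ i, (pderiv i f).totalDegree ≤ d := fun i =>
    (totalDegree_pderiv_le i f).trans (Nat.sub_le _ _)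
  have h2 : ∀ i j, (pderiv i (pderiv j f)).totalDegree ≤ d := fun i j =>
    (totalDegree_pderiv_le i _).trans ((Nat.sub_le _ _).trans (h1 j))
  have p2 : ∀ i, (pderiv i f ^ 2).totalDegree ≤ 2 * d := fun i =>
    (totalDegree_pow _ _).trans (Nat.mul_le_mul_left _ (h1 i))
  have p3 : ∀ i, (pderiv i f ^ 3).totalDegree ≤ 3 * d := fun i =>
    (totalDegree_pow _ _).trans (Nat.mul_le_mul_left _ (h1 i))
  have q1 : ∀ i j, (-2 * pderiv i (pderiv j f)).totalDegree ≤ d := fun i j =>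
    hmul hmtwo (h2 i j) (by omega)
  have q2 : (2 * pderiv 2 (pderiv 0 f) + pderiv 1 (pderiv 1 f)).totalDegree ≤ d :=
    hadd (hmul htwo (h2 _ _) (by omega)) (h2 _ _)
  have m2 : ∀ i j, (pderiv i f * pderiv j f).totalDegree ≤ 2 * d := fun i j =>
    hmul (h1 i) (h1 j) (by omega)
  have eac : (pderiv 1 f ^ 2 - pderiv 2 f * pderiv 0 f).totalDegree ≤ 2 * d := hsub (p2 1) (m2 _ _)
  constructor
  · refine hsub (hsub (hsub ?_ ?_) ?_) ?_
    · exact hmul (p3 _) (h2 _ _) (by omega)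
    · exact hmul (hmul (p2 _) (h1 _) le_rfl) q2 (by omega)
    · exact hmul (hmul (m2 _ _) (h1 _) le_rfl) (q1 _ _) (by omega)
    · exact hmul (hmul (h1 _) eac le_rfl) (h2 _ _) (by omega)
  · refine hadd (hadd (hadd ?_ ?_) ?_) ?_
    · exact hmul (p3 _) (q1 _ _) (by omega)
    · exact hmul (hmul (p2 _) (h1 _) le_rfl) q2 (by omega)
    · exact hmul (hmul (h1 _) eac le_rfl) (q1 _ _) (by omega)
    · refine hmul (m := 3 * d) (hsub (p3 _) ?_) (h2 _ _) (by omega)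
      exact hmul (hmul (hmul htwo (h1 _) le_rfl) (h1 _) le_rfl) (h1 _) (by omega)

open MvPolynomial in
theorem pderiv_pderiv_comm {σ : Type*} (i j : σ) (f : MvPolynomial σ K) :
    pderiv i (pderiv j f) = pderiv j (pderiv i f) := by
  classical
  ext m
  simp only [coeff_pderiv, Finsupp.add_apply, Finsupp.single_apply]
  rw [add_right_comm]
  by_cases h : i = j
  · subst h; rfl
  · simp [h, Ne.symm h]; ring

namespace NLine

variable (l l' : NLine K)

open MvPolynomial in
theorem derivative_derivative_restrict (f : MvPolynomial (Fin 3) K) :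
    Polynomial.derivative (Polynomial.derivative (l.restrict f)) = l.restrict
      (pderiv 2 (pderiv 2 f) + (-2 * pderiv 2 (pderiv 1 f)) * C l.s +
        (2 * pderiv 2 (pderiv 0 f) + pderiv 1 (pderiv 1 f)) * C l.s ^ 2 +
        (-2 * pderiv 1 (pderiv 0 f)) * C l.s ^ 3 + pderiv 0 (pderiv 0 f) * C l.s ^ 4) := by
  rw [derivative_restrict, derivative_restrict]
  congr 1
  simp only [map_add, map_sub, pderiv_C_mul, C_pow]
  simp only [← C_pow, pderiv_C_mul]
  rw [pderiv_pderiv_comm 1 2 f, pderiv_pderiv_comm 0 2 f, pderiv_pderiv_comm 0 1 f]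
  simp only [C_pow]
  ring

open MvPolynomial in
/-- Reduction of the second derivative along a line modulo the first derivative. -/
theorem exists_second_order (f : MvPolynomial (Fin 3) K) : ∃ Q : Polynomial K,
    l.restrict (pderiv 0 f) ^ 3 * Polynomial.derivative (Polynomial.derivative (l.restrict f)) =
      Q * Polynomial.derivative (l.restrict f) +
        (Polynomial.C l.s * l.restrict (asymptoticRemainder f).2 +
          l.restrict (asymptoticRemainder f).1) := by
  set a := pderiv 2 f
  set e := pderiv 1 f
  set c := pderiv 0 f
  refine ⟨l.restrict (c ^ 2 * (2 * pderiv 2 c + pderiv 1 e) +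
    c * (-2 * pderiv 1 c) * (c * C l.s + e) +
    pderiv 0 c * (c ^ 2 * C l.s ^ 2 + c * e * C l.s + e ^ 2 - a * c)), ?_⟩
  have hC : (Polynomial.C l.s) = l.restrict (C l.s) := by simp [restrict]
  rw [derivative_derivative_restrict, derivative_restrict, hC]
  simp only [← map_mul, ← map_add, ← map_pow, asymptoticRemainder]
  congr 1
  simp only [map_pow]
  ring


/-- At a meeting point of two lines on a surface the asymptotic remainder vanishes, and the
tangency form factors through the two slopes. -/
theorem eval_of_meet {f : MvPolynomial (Fin 3) K} {l l' : NLine K} (hl : l.restrict f = 0)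
    (hl' : l'.restrict f = 0) (hs : l.s ≠ l'.s) (h : l.form l' = 0) :
    let x := l.pt ((l.b - l'.b) / (l.s - l'.s))
    MvPolynomial.eval x (asymptoticRemainder f).1 = 0 ∧
    MvPolynomial.eval x (asymptoticRemainder f).2 = 0 ∧
    MvPolynomial.eval x (MvPolynomial.pderiv 1 f) =
      (l.s + l'.s) * MvPolynomial.eval x (MvPolynomial.pderiv 0 f) := by
  intro x
  have hx : x = l'.pt ((l.b - l'.b) / (l.s - l'.s)) := pt_eq_pt hs h
  set t := (l.b - l'.b) / (l.s - l'.s)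
  have hs' := sub_ne_zero.2 hs
  have key : ∀ w : NLine K, w.restrict f = 0 → x = w.pt t →
      w.s * MvPolynomial.eval x (asymptoticRemainder f).2 +
        MvPolynomial.eval x (asymptoticRemainder f).1 = 0 ∧
      MvPolynomial.eval x (MvPolynomial.pderiv 2 f) -
        w.s * MvPolynomial.eval x (MvPolynomial.pderiv 1 f) +
        w.s ^ 2 * MvPolynomial.eval x (MvPolynomial.pderiv 0 f) = 0 := by
    intro w hw hxw
    constructor
    · obtain ⟨Q, hQ⟩ := w.exists_second_order f
      have := congrArg (Polynomial.eval t) hQ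
      simpa [hw, eval_restrict, ← hxw] using this.symm
    · have := congrArg (Polynomial.eval t) (w.derivative_restrict f)
      simpa [hw, eval_restrict, ← hxw] using this.symm
  obtain ⟨k1, k2⟩ := key l hl rfl
  obtain ⟨k3, k4⟩ := key l' hl' hx
  have r1 : MvPolynomial.eval x (asymptoticRemainder f).2 = 0 := by
    apply mul_left_cancel₀ hs'
    linear_combination k1 - k3
  refine ⟨by linear_combination k1 - l.s * r1, r1, ?_⟩
  apply mul_left_cancel₀ hs'
  linear_combination k4 - k2

/-- If the asymptotic remainder vanishes on the surface, every asymptotic isotropic direction at a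
point with `f_z ≠ 0` spans a line on the surface. -/
theorem restrict_eq_zero_of_dvd {p : ℕ} [CharP K p] {f : MvPolynomial (Fin 3) K}
    (hp : f.totalDegree < p) (h1 : f ∣ (asymptoticRemainder f).1)
    (h2 : f ∣ (asymptoticRemainder f).2) (w : NLine K) (t : K)
    (hf : MvPolynomial.eval (w.pt t) f = 0)
    (hz : MvPolynomial.eval (w.pt t) (MvPolynomial.pderiv 0 f) ≠ 0)
    (htan : MvPolynomial.eval (w.pt t) (MvPolynomial.pderiv 2 f) -
        w.s * MvPolynomial.eval (w.pt t) (MvPolynomial.pderiv 1 f) +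
        w.s ^ 2 * MvPolynomial.eval (w.pt t) (MvPolynomial.pderiv 0 f) = 0) :
    w.restrict f = 0 := by
  obtain ⟨Q, hQ⟩ := w.exists_second_order f
  obtain ⟨u, hu⟩ := h1
  obtain ⟨v, hv⟩ := h2
  refine eq_zero_of_second_order (p := p) (t := t) (C := w.restrict (MvPolynomial.pderiv 0 f) ^ 3)
    (q := Q) (r := Polynomial.C w.s * w.restrict v + w.restrict u)
    ((w.natDegree_restrict_le f).trans_lt hp) ?_ ?_ ?_ ?_
  · rw [hQ, hu, hv, map_mul, map_mul]
    ring
  · rw [eval_restrict, hf]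
  · rw [derivative_restrict, eval_restrict]
    simpa using htan
  · rw [Polynomial.eval_pow, eval_restrict]
    exact pow_ne_zero _ hz

/-- `y - b + s x`. -/
noncomputable def den (l : NLine K) : MvPolynomial (Fin 3) K :=
  MvPolynomial.X 1 - MvPolynomial.C l.b + MvPolynomial.C l.s * MvPolynomial.X 2

/-- `z - c + s (y - b)`. -/
noncomputable def num (l : NLine K) : MvPolynomial (Fin 3) K :=
  MvPolynomial.X 0 - MvPolynomial.C l.c +
    MvPolynomial.C l.s * (MvPolynomial.X 1 - MvPolynomial.C l.b)

/-- The condition that the isotropic direction from a point to the line `l` is tangent. -/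
noncomputable def transversalForm (f : MvPolynomial (Fin 3) K) (l : NLine K) :
    MvPolynomial (Fin 3) K :=
  MvPolynomial.pderiv 2 f * l.den ^ 2 + MvPolynomial.pderiv 1 f * l.num * l.den +
    MvPolynomial.pderiv 0 f * l.num ^ 2

/-- A determinant vanishing where the isotropic directions towards two lines agree. -/
noncomputable def crossForm (l l' : NLine K) : MvPolynomial (Fin 3) K :=
  l.den * l'.num - l'.den * l.num

theorem eval_den (w : NLine K) (t : K) :
    MvPolynomial.eval (w.pt t) l.den = (w.b - l.b) + (l.s - w.s) * t := by
  simp [den, pt]; ring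

theorem eval_num (w : NLine K) (t : K) :
    MvPolynomial.eval (w.pt t) l.num =
      w.form l - w.s * MvPolynomial.eval (w.pt t) l.den := by
  simp [num, den, pt, form]; ring


theorem dvd_transversalForm {p : ℕ} [CharP K p] [Infinite K] {f : MvPolynomial (Fin 3) K}
    (hf : Irreducible f) (hp : f.totalDegree < p) (h1 : f ∣ (asymptoticRemainder f).1)
    (h2 : f ∣ (asymptoticRemainder f).2) (hl : l.restrict f = 0)
    (hz : l.restrict (MvPolynomial.pderiv 0 f) ≠ 0)
    (hdouble : l.restrict (MvPolynomial.pderiv 1 f -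
      MvPolynomial.C (2 * l.s) * MvPolynomial.pderiv 0 f) ≠ 0) :
    f ∣ transversalForm f l := by
  classical
  by_contra hnd
  set P := l.restrict (MvPolynomial.pderiv 0 f) * l.restrict (MvPolynomial.pderiv 1 f -
      MvPolynomial.C (2 * l.s) * MvPolynomial.pderiv 0 f) with hP
  have hP0 : P ≠ 0 := mul_ne_zero hz hdouble
  set N := f.totalDegree * (2 * (transversalForm f l).totalDegree + 1)
  obtain ⟨T, hT, hTcard⟩ := (Set.Finite.infinite_compl
    (P.roots.toFinset : Set K).toFinite).exists_subset_card_eq (N + 1)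
  have hgood : ∀ t ∈ T, MvPolynomial.eval (l.pt t) (MvPolynomial.pderiv 0 f) ≠ 0 ∧
      MvPolynomial.eval (l.pt t) (MvPolynomial.pderiv 1 f) -
        2 * l.s * MvPolynomial.eval (l.pt t) (MvPolynomial.pderiv 0 f) ≠ 0 := by
    intro t ht
    have h3 := hT ht
    simp only [Set.mem_compl_iff, Finset.mem_coe, Multiset.mem_toFinset,
      Polynomial.mem_roots hP0, Polynomial.IsRoot.def] at h3
    rw [hP, Polynomial.eval_mul, eval_restrict, eval_restrict] at h3
    simpa [not_or] using h3
  let σ : K → K := fun t => MvPolynomial.eval (l.pt t) (MvPolynomial.pderiv 1 f) /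
    MvPolynomial.eval (l.pt t) (MvPolynomial.pderiv 0 f) - l.s
  have hσ : ∀ t ∈ T, σ t - l.s ≠ 0 := by
    intro t ht h
    obtain ⟨g1, g2⟩ := hgood t ht
    apply g2
    simp only [σ] at h
    field_simp at h
    linear_combination h
  have hinj : Set.InjOn (fun t => (σ t, l.b + (σ t - l.s) * t)) T := by
    intro t ht u _ he
    simp only [Prod.mk.injEq] at he
    obtain ⟨e1, e2⟩ := he
    rw [← e1] at e2
    exact mul_left_cancel₀ (hσ t ht) (add_left_cancel e2)
  have hbound := card_common_lines_le hf hnd (T.image fun t => (σ t, l.b + (σ t - l.s) * t)) (by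
    intro τ hτ
    obtain ⟨t, ht, rfl⟩ := Finset.mem_image.1 hτ
    obtain ⟨g1, -⟩ := hgood t ht
    refine ⟨l.c + (l.s ^ 2 - σ t ^ 2) * t, ?_⟩
    set w : NLine K := ⟨σ t, l.b + (σ t - l.s) * t, l.c + (l.s ^ 2 - σ t ^ 2) * t⟩ with hw
    have hpt : w.pt t = l.pt t := by
      ext i
      fin_cases i
      · simp [pt, hw]; ring
      · simp [pt, hw]; ring
      · simp [pt]
    have hft : MvPolynomial.eval (l.pt t) f = 0 := by rw [← eval_restrict, hl]; simp
    have htan : MvPolynomial.eval (l.pt t) (MvPolynomial.pderiv 2 f) -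
        l.s * MvPolynomial.eval (l.pt t) (MvPolynomial.pderiv 1 f) +
        l.s ^ 2 * MvPolynomial.eval (l.pt t) (MvPolynomial.pderiv 0 f) = 0 := by
      have := congrArg (Polynomial.eval t) (l.derivative_restrict f)
      simpa [hl, eval_restrict] using this.symm
    have hsum : MvPolynomial.eval (l.pt t) (MvPolynomial.pderiv 1 f) =
        (w.s + l.s) * MvPolynomial.eval (l.pt t) (MvPolynomial.pderiv 0 f) := by
      simp only [hw, σ]
      field_simp
      ring
    have hwf : w.restrict f = 0 := by
      refine restrict_eq_zero_of_dvd hp h1 h2 w t ?_ ?_ ?_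
      · rwa [hpt]
      · rwa [hpt]
      · rw [hpt]
        linear_combination htan + (l.s - w.s) * hsum
    refine ⟨hwf, ?_⟩
    have hform : w.form l = 0 := form_eq_zero_of_pt_eq hpt
    refine Polynomial.funext fun u => ?_
    have h3 := congrArg (Polynomial.eval u) (w.derivative_restrict f)
    simp only [hwf, eval_restrict, Polynomial.derivative_zero, Polynomial.eval_zero] at h3
    simp only [map_add, map_sub, map_mul, MvPolynomial.eval_C] at h3
    rw [eval_restrict, Polynomial.eval_zero, transversalForm]
    simp only [map_add, map_mul, map_pow, eval_num, hform]
    linear_combination -(MvPolynomial.eval (w.pt u) l.den) ^ 2 * h3)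
  rw [Finset.card_image_of_injOn hinj, hTcard] at hbound
  omega

theorem dvd_crossForm {f : MvPolynomial (Fin 3) K} (hf : Irreducible f)
    (hz : ¬ f ∣ MvPolynomial.pderiv 0 f) {l₁ l₂ l₃ : NLine K} (h1 : f ∣ transversalForm f l₁)
    (h2 : f ∣ transversalForm f l₂) (h3 : f ∣ transversalForm f l₃) :
    f ∣ crossForm l₁ l₂ ∨ f ∣ crossForm l₁ l₃ ∨ f ∣ crossForm l₂ l₃ := by
  have hprod : f ∣ MvPolynomial.pderiv 0 f *
      (crossForm l₁ l₂ * (crossForm l₁ l₃ * crossForm l₂ l₃)) := by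
    have : MvPolynomial.pderiv 0 f * (crossForm l₁ l₂ * (crossForm l₁ l₃ * crossForm l₂ l₃)) =
        transversalForm f l₁ * (l₂.den * l₃.den * crossForm l₂ l₃) -
        transversalForm f l₂ * (l₁.den * l₃.den * crossForm l₁ l₃) +
        transversalForm f l₃ * (l₁.den * l₂.den * crossForm l₁ l₂) := by
      simp only [crossForm, transversalForm]
      ring
    rw [this]
    exact dvd_add (dvd_sub (h1.mul_right _) (h2.mul_right _)) (h3.mul_right _)
  rcases hf.prime.dvd_or_dvd hprod with h | h
  · exact absurd h hz
  · rcases hf.prime.dvd_or_dvd h with h | h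
    · exact Or.inl h
    · exact Or.inr (hf.prime.dvd_or_dvd h)

/-- On a surface where the isotropic directions towards `l` and `l'` agree, every line meeting `l`
meets `l'`. -/
theorem form_eq_zero_of_dvd_crossForm [Infinite K] {f : MvPolynomial (Fin 3) K} {l l' w : NLine K}
    (h : f ∣ crossForm l l') (hw : w.restrict f = 0) (hs : l.s ≠ w.s) (hlw : l.form w = 0) :
    l'.form w = 0 := by
  obtain ⟨g, hg⟩ := h
  have hs' := sub_ne_zero.2 hs
  have hwl : w.form l = 0 := by rw [form_swap, hlw, neg_zero]
  set t := (1 - (w.b - l.b)) / (l.s - w.s) with ht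
  have h1 := congrArg (MvPolynomial.eval (w.pt t)) hg
  rw [map_mul, ← eval_restrict w t f, hw, Polynomial.eval_zero, zero_mul, crossForm] at h1
  simp only [map_sub, map_mul, eval_num, hwl] at h1
  have h2 : MvPolynomial.eval (w.pt t) l.den = 1 := by
    rw [eval_den, ht]
    field_simp
    ring
  rw [h2] at h1
  rw [form_swap, neg_eq_zero]
  linear_combination h1

end NLine

open NLine in
/-- On an irreducible surface, few lines of a skew family can be rich in transversals from another
skew family, unless two of them share many transversals. -/
theorem card_rich_lines_le {p : ℕ} [CharP K p] [Infinite K] [DecidableEq K]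
    {f : MvPolynomial (Fin 3) K}
    (hf : Irreducible f) (hp : f.totalDegree < p) (k : ℕ) (L L' : Finset (NLine K))
    (hL : ∀ l ∈ L, l.restrict f = 0) (hL' : ∀ l ∈ L', l.restrict f = 0)
    (hs : ∀ l ∈ L, ∀ w ∈ L', l.s ≠ w.s)
    (hinj : Set.InjOn (fun l : NLine K => (l.s, l.b)) L)
    (hskew' : ∀ w ∈ L', ∀ w' ∈ L', w ≠ w' → w.form w' ≠ 0)
    (hrich : ∀ l ∈ L, 4 * f.totalDegree < (L'.filter fun w => l.form w = 0).card ∧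
      k < (L'.filter fun w => l.form w = 0).card)
    (hcommon : ∀ l ∈ L, ∀ l' ∈ L, l ≠ l' →
      (L'.filter fun w => l.form w = 0 ∧ l'.form w = 0).card ≤ k) :
    L.card ≤ 11 * f.totalDegree ^ 2 := by
  classical
  set d := f.totalDegree with hd
  have hd1 : 1 ≤ d := by
    by_contra h
    have h0 : f.totalDegree = 0 := by omega
    rw [MvPolynomial.totalDegree_eq_zero_iff_eq_C] at h0
    rw [h0] at hf
    refine hf.not_isUnit (IsUnit.map MvPolynomial.C (IsUnit.mk0 _ fun h => ?_))
    rw [h, MvPolynomial.C_0] at hf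
    exact hf.ne_zero rfl
  have hnbr : ∀ l ∈ L, ∀ w ∈ L'.filter (fun w => l.form w = 0), l.s ≠ w.s ∧ l.form w = 0 :=
    fun l hl w hw => ⟨hs l hl w (Finset.mem_filter.1 hw).1, (Finset.mem_filter.1 hw).2⟩
  have hskewN : ∀ l : NLine K, ∀ w ∈ L'.filter (fun w => l.form w = 0),
      ∀ w' ∈ L'.filter (fun w => l.form w = 0), w ≠ w' → w.form w' ≠ 0 :=
    fun l w hw w' hw' => hskew' w (Finset.mem_filter.1 hw).1 w' (Finset.mem_filter.1 hw').1
  have hvanish : ∀ g : MvPolynomial (Fin 3) K, g.totalDegree ≤ 4 * d → ∀ l ∈ L,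
      (∀ w ∈ L', l.s ≠ w.s → l.form w = 0 → w.restrict f = 0 →
        MvPolynomial.eval (l.pt ((l.b - w.b) / (l.s - w.s))) g = 0) → l.restrict g = 0 := by
    intro g hg l hl h
    refine restrict_eq_zero_of_meet g _ (hnbr l hl) (hskewN l) (fun w hw => ?_)
      (hg.trans_lt (hrich l hl).1)
    have hw' := (Finset.mem_filter.1 hw).1
    exact h w hw' (hnbr l hl w hw).1 (hnbr l hl w hw).2 (hL' w hw')
  have hbezout : ∀ g : MvPolynomial (Fin 3) K, ¬ f ∣ g → ∀ S ⊆ L, (∀ l ∈ S, l.restrict g = 0) →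
      S.card ≤ d * (2 * g.totalDegree + 1) := by
    intro g hg S hS h
    rw [← Finset.card_image_of_injOn (hinj.mono hS)]
    refine card_common_lines_le hf hg _ fun τ hτ => ?_
    obtain ⟨l, hl, rfl⟩ := Finset.mem_image.1 hτ
    exact ⟨l.c, hL l (hS hl), h l hl⟩
  have hdd : d ≤ d ^ 2 := by nlinarith
  obtain ⟨hdeg1, hdeg2⟩ := totalDegree_asymptoticRemainder_le f
  by_cases h1 : f ∣ (asymptoticRemainder f).1
  swap
  · refine (hbezout _ h1 L le_rfl fun l hl => hvanish _ hdeg1 l hl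
      fun w _ hs hw hwf => (eval_of_meet (hL l hl) hwf hs hw).1).trans ?_
    nlinarith [Nat.mul_le_mul_left d hdeg1]
  by_cases h2 : f ∣ (asymptoticRemainder f).2
  swap
  · refine (hbezout _ h2 L le_rfl fun l hl => hvanish _ hdeg2 l hl
      fun w _ hs hw hwf => (eval_of_meet (hL l hl) hwf hs hw).2.1).trans ?_
    nlinarith [Nat.mul_le_mul_left d hdeg2]
  by_cases hz0 : MvPolynomial.pderiv 0 f = 0
  · obtain ⟨r, hr⟩ := Polynomial.natDegree_eq_zero.1 (natDegree_finSuccEquiv_eq_zero hp hz0)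
    have hr0 : r ≠ 0 := by
      rintro rfl
      exact hf.ne_zero (by simpa using hr.symm)
    have hrd : r.totalDegree ≤ d := by
      have := totalDegree_coeff_finSuccEquiv_le f 0
      rwa [← hr, Polynomial.coeff_C_zero] at this
    rw [← Finset.card_image_of_injOn hinj]
    refine (card_lines_le_totalDegree hr0 _ fun τ hτ t => ?_).trans (by omega)
    obtain ⟨l, hl, rfl⟩ := Finset.mem_image.1 hτ
    have h3 : MvPolynomial.eval (l.pt t) f = 0 := by rw [← eval_restrict, hL l hl]; simp
    rw [eval_eq_eval_finSuccEquiv, ← hr] at h3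
    have h4 : Fin.tail (l.pt t) = ![l.b - l.s * t, t] := by
      ext i
      fin_cases i <;> simp [NLine.pt, Fin.tail]
    simpa [h4] using h3
  have hz := not_dvd_pderiv hz0
  have hzd : (MvPolynomial.pderiv 0 f).totalDegree ≤ d :=
    (totalDegree_pderiv_le 0 f).trans (Nat.sub_le _ _)
  by_contra! hcard
  have hS := hbezout _ hz (L.filter fun l => l.restrict (MvPolynomial.pderiv 0 f) = 0)
    (Finset.filter_subset _ _) (fun l hl => (Finset.mem_filter.1 hl).2)
  have hsplit := Finset.card_filter_add_card_filter_not (s := L)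
    (fun l => l.restrict (MvPolynomial.pderiv 0 f) = 0)
  have hthree : 2 < (L.filter fun l => ¬ l.restrict (MvPolynomial.pderiv 0 f) = 0).card := by
    nlinarith [Nat.mul_le_mul_left d hzd]
  obtain ⟨l₁, l₂, l₃, m1, m2, m3, h12, h13, h23⟩ := Finset.two_lt_card_iff.1 hthree
  have hT : ∀ l ∈ L.filter (fun l => ¬ l.restrict (MvPolynomial.pderiv 0 f) = 0),
      f ∣ transversalForm f l := by
    intro l hl
    obtain ⟨hlL, hlz⟩ := Finset.mem_filter.1 hl
    refine l.dvd_transversalForm hf hp h1 h2 (hL l hlL) hlz fun hdouble => hlz ?_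
    refine hvanish _ (hzd.trans (by omega)) l hlL fun w _ hs hw hwf => ?_
    have e1 := (eval_of_meet (hL l hlL) hwf hs hw).2.2
    have e2 := congrArg (Polynomial.eval ((l.b - w.b) / (l.s - w.s))) hdouble
    rw [eval_restrict] at e2
    simp only [map_sub, map_mul, MvPolynomial.eval_C, Polynomial.eval_zero] at e2
    apply mul_left_cancel₀ (sub_ne_zero.2 hs)
    linear_combination e1 - e2
  have hpair : ∀ l ∈ L, ∀ l' ∈ L, l ≠ l' → ¬ f ∣ crossForm l l' := by
    intro l hl l' hl' hne hdvd
    have h3 := hcommon l hl l' hl' hne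
    have h4 : (L'.filter fun w => l.form w = 0) ⊆
        L'.filter fun w => l.form w = 0 ∧ l'.form w = 0 := by
      intro w hw
      obtain ⟨w1, w2⟩ := Finset.mem_filter.1 hw
      exact Finset.mem_filter.2 ⟨w1, w2,
        form_eq_zero_of_dvd_crossForm hdvd (hL' w w1) (hs l hl w w1) w2⟩
    exact absurd ((Finset.card_le_card h4).trans h3) (not_le.2 (hrich l hl).2)
  have mem := fun l hl => (Finset.mem_filter (p := fun l : NLine K =>
    ¬ l.restrict (MvPolynomial.pderiv 0 f) = 0) (s := L) (a := l)).1 hl |>.1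
  rcases dvd_crossForm hf hz (hT _ m1) (hT _ m2) (hT _ m3) with h | h | h
  · exact hpair _ (mem _ m1) _ (mem _ m2) h12 h
  · exact hpair _ (mem _ m1) _ (mem _ m3) h13 h
  · exact hpair _ (mem _ m2) _ (mem _ m3) h23 h

end Surfaces

section Bipartite

variable {α β : Type*} (r : α → β → Prop)
  [∀ a b, Decidable (r a b)]

/-- The number of incidences between two finite sets. -/
def incid (s : Finset α) (t : Finset β) : ℕ := ∑ a ∈ s, (t.filter (r a)).card

theorem incid_eq_sum_right (s : Finset α) (t : Finset β) :
    incid r s t = ∑ b ∈ t, (s.filter fun a => r a b).card :=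
  Finset.sum_card_bipartiteAbove_eq_sum_card_bipartiteBelow r

theorem incid_filter_left (s : Finset α) (t : Finset β) (P : α → Prop) [DecidablePred P] :
    incid r s t = incid r (s.filter P) t + incid r (s.filter fun a => ¬ P a) t :=
  (Finset.sum_filter_add_sum_filter_not s P _).symm

theorem incid_filter_right (s : Finset α) (t : Finset β) (P : β → Prop) [DecidablePred P] :
    incid r s t = incid r s (t.filter P) + incid r s (t.filter fun b => ¬ P b) := by
  simp only [incid_eq_sum_right]
  exact (Finset.sum_filter_add_sum_filter_not t P _).symm

/-- Removing vertices of small degree. -/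
theorem incid_le_of_rich [DecidableEq α] [DecidableEq β] (θ X : ℕ) (s : Finset α) (t : Finset β)
    (h : ∀ s' ⊆ s, ∀ t' ⊆ t, (∀ a ∈ s', θ < (t'.filter (r a)).card) →
      (∀ b ∈ t', θ < (s'.filter fun a => r a b).card) → incid r s' t' ≤ X) :
    incid r s t ≤ θ * (s.card + t.card) + X := by
  by_cases h1 : ∀ a ∈ s, θ < (t.filter (r a)).card
  · by_cases h2 : ∀ b ∈ t, θ < (s.filter fun a => r a b).card
    · exact (h s le_rfl t le_rfl h1 h2).trans (Nat.le_add_left _ _)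
    · push Not at h2
      obtain ⟨b, hb, hdeg⟩ := h2
      have ih := incid_le_of_rich θ X s (t.erase b) fun s' hs' t' ht' =>
        h s' hs' t' (ht'.trans (Finset.erase_subset _ _))
      rw [incid_eq_sum_right] at ih ⊢
      rw [← Finset.add_sum_erase _ _ hb]
      have hc := Finset.card_erase_add_one hb
      nlinarith
  · push Not at h1
    obtain ⟨a, ha, hdeg⟩ := h1
    have ih := incid_le_of_rich θ X (s.erase a) t fun s' hs' t' ht' =>
      h s' (hs'.trans (Finset.erase_subset _ _)) t' ht'
    unfold incid at ih ⊢
    rw [← Finset.add_sum_erase _ _ ha]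
    have hc := Finset.card_erase_add_one ha
    nlinarith
termination_by s.card + t.card
decreasing_by
  · have := Finset.card_erase_lt_of_mem hb; omega
  · have := Finset.card_erase_lt_of_mem ha; omega

/-- The Kővári–Sós–Turán inequality for pairs with at most `k` common neighbours. -/
theorem incid_sq_le [DecidableEq α] (k : ℕ) (s : Finset α) (t : Finset β)
    (h : ∀ a ∈ s, ∀ a' ∈ s, a ≠ a' → (t.filter fun b => r a b ∧ r a' b).card ≤ k) :
    incid r s t ^ 2 ≤ t.card * (incid r s t + s.card ^ 2 * k) := by
  have h1 : incid r s t ^ 2 ≤ t.card * ∑ b ∈ t, (s.filter fun a => r a b).card ^ 2 := by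
    rw [incid_eq_sum_right]
    exact sq_sum_le_card_mul_sum_sq
  refine h1.trans (Nat.mul_le_mul_left _ ?_)
  have h2 : ∑ b ∈ t, (s.filter fun a => r a b).card ^ 2 =
      ∑ q ∈ s ×ˢ s, (t.filter fun b => r q.1 b ∧ r q.2 b).card := by
    rw [← incid_eq_sum_right (fun b (q : α × α) => r q.1 b ∧ r q.2 b), incid]
    refine Finset.sum_congr rfl fun b _ => ?_
    rw [sq, ← Finset.card_product]
    congr 1
    ext q
    simp only [Finset.mem_product, Finset.mem_filter]
    tauto
  rw [h2, ← Finset.diag_union_offDiag, Finset.sum_union (Finset.disjoint_diag_offDiag s)]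
  refine add_le_add ?_ ?_
  · simp [Finset.sum_diag, incid]
  · refine (Finset.sum_le_card_nsmul _ _ k fun q hq => ?_).trans ?_
    · obtain ⟨q1, q2, q3⟩ := Finset.mem_offDiag.1 hq
      exact h _ q1 _ q2 q3
    · rw [smul_eq_mul, Finset.offDiag_card]
      exact Nat.mul_le_mul_right _ ((Nat.sub_le _ _).trans (by rw [sq]))

end Bipartite

section Families

variable {K : Type*} [Field K]

open scoped Classical

/-- Two skew families of isotropic lines such that two lines of one family have at most `k` common
transversals in the other. -/
structure TransversalFamilies (k : ℕ) (L L' : Finset (NLine K)) : Prop where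
  slope : ∀ l ∈ L, ∀ w ∈ L', l.s ≠ w.s
  inj : Set.InjOn (fun l : NLine K => (l.s, l.b)) L
  inj' : Set.InjOn (fun l : NLine K => (l.s, l.b)) L'
  skew : ∀ l ∈ L, ∀ l' ∈ L, l ≠ l' → l.form l' ≠ 0
  skew' : ∀ w ∈ L', ∀ w' ∈ L', w ≠ w' → w.form w' ≠ 0
  common : ∀ l ∈ L, ∀ l' ∈ L, l ≠ l' →
    (L'.filter fun w => l.form w = 0 ∧ l'.form w = 0).card ≤ k
  common' : ∀ w ∈ L', ∀ w' ∈ L', w ≠ w' →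
    (L.filter fun l => l.form w = 0 ∧ l.form w' = 0).card ≤ k

theorem NLine.form_eq_zero_comm {l w : NLine K} : w.form l = 0 ↔ l.form w = 0 := by
  rw [NLine.form_swap, neg_eq_zero]

namespace TransversalFamilies

variable {k : ℕ} {L L' M M' : Finset (NLine K)}

theorem symm (h : TransversalFamilies k L L') : TransversalFamilies k L' L where
  slope l hl w hw := (h.slope w hw l hl).symm
  inj := h.inj'
  inj' := h.inj
  skew := h.skew'
  skew' := h.skew
  common l hl l' hl' hne := by
    simpa only [NLine.form_eq_zero_comm (w := l), NLine.form_eq_zero_comm (w := l')] using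
      h.common' l hl l' hl' hne
  common' l hl l' hl' hne := by
    simpa only [NLine.form_eq_zero_comm (l := l), NLine.form_eq_zero_comm (l := l')] using
      h.common l hl l' hl' hne

theorem mono (h : TransversalFamilies k L L') (hM : M ⊆ L) (hM' : M' ⊆ L') :
    TransversalFamilies k M M' where
  slope l hl w hw := h.slope l (hM hl) w (hM' hw)
  inj := h.inj.mono hM
  inj' := h.inj'.mono hM'
  skew l hl l' hl' := h.skew l (hM hl) l' (hM hl')
  skew' l hl l' hl' := h.skew' l (hM' hl) l' (hM' hl')
  common l hl l' hl' hne := (Finset.card_le_card (Finset.filter_subset_filter _ hM')).trans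
    (h.common l (hM hl) l' (hM hl') hne)
  common' l hl l' hl' hne := (Finset.card_le_card (Finset.filter_subset_filter _ hM)).trans
    (h.common' l (hM' hl) l' (hM' hl') hne)

/-- The incidence count of two families of lines. -/
noncomputable abbrev meets (L L' : Finset (NLine K)) : ℕ :=
  incid (fun l w : NLine K => l.form w = 0) L L'

theorem meets_comm (L L' : Finset (NLine K)) : meets L L' = meets L' L := by
  rw [meets, incid_eq_sum_right]
  simp only [meets, incid, NLine.form_eq_zero_comm]

/-- A line outside a surface meets few lines of a skew family inside it. -/
theorem meets_le_of_not_restrict (h : TransversalFamilies k L L') (f : MvPolynomial (Fin 3) K)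
    (hL : ∀ l ∈ L, l.restrict f ≠ 0) (hL' : ∀ w ∈ L', w.restrict f = 0) :
    meets L L' ≤ f.totalDegree * L.card := by
  rw [mul_comm]
  refine Finset.sum_le_card_nsmul _ _ _ fun l hl => ?_
  by_contra! hcard
  refine hL l hl (NLine.restrict_eq_zero_of_meet f _ (fun w hw => ?_) (fun w hw w' hw' => ?_)
    (fun w hw => ?_) hcard)
  · obtain ⟨h1, h2⟩ := Finset.mem_filter.1 hw
    exact ⟨h.slope l hl w h1, h2⟩
  · exact h.skew' w (Finset.mem_filter.1 hw).1 w' (Finset.mem_filter.1 hw').1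
  · obtain ⟨h1, h2⟩ := Finset.mem_filter.1 hw
    rw [NLine.pt_eq_pt (h.slope l hl w h1) h2, ← NLine.eval_restrict, hL' w h1]
    simp

variable {p : ℕ} [CharP K p] [Infinite K] {κ : ℕ}

theorem meets_le_of_irreducible (h : TransversalFamilies k L L') (hk : k ≤ κ ^ 2)
    {f : MvPolynomial (Fin 3) K} (hf : Irreducible f) (hp : f.totalDegree < p)
    (hL : ∀ l ∈ L, l.restrict f = 0) (hL' : ∀ w ∈ L', w.restrict f = 0) :
    meets L L' ≤ (4 * f.totalDegree + k) * (L.card + L'.card) +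
      55 * (f.totalDegree ^ 3 * (κ + 1)) := by
  refine incid_le_of_rich _ _ _ _ _ fun M hM M' hM' hrich hrich' => ?_
  have hT := h.mono hM hM'
  set d := f.totalDegree with hd
  have hrich2 : ∀ w ∈ M', 4 * d + k < (M.filter fun l => w.form l = 0).card := by
    simpa only [NLine.form_eq_zero_comm] using hrich'
  have c1 : M.card ≤ 11 * d ^ 2 := card_rich_lines_le hf hp k M M' (fun l hl => hL l (hM hl))
    (fun w hw => hL' w (hM' hw)) hT.slope hT.inj hT.skew'
    (fun l hl => by have := hrich l hl; constructor <;> omega)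
    (fun l hl l' hl' hne => by convert hT.common l hl l' hl' hne)
  have c2 : M'.card ≤ 11 * d ^ 2 := card_rich_lines_le hf hp k M' M (fun l hl => hL' l (hM' hl))
    (fun w hw => hL w (hM hw)) hT.symm.slope hT.inj' hT.skew
    (fun l hl => by have := hrich2 l hl; constructor <;> omega)
    (fun l hl l' hl' hne => by convert hT.symm.common l hl l' hl' hne)
  have hsq := incid_sq_le (fun l w : NLine K => l.form w = 0) k M M' (fun l hl l' hl' hne => by
    convert hT.common l hl l' hl' hne)
  set I := incid (fun l w : NLine K => l.form w = 0) M M'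
  by_contra! hI
  have hd2 : d ^ 2 ≤ d ^ 3 := by
    rcases Nat.eq_zero_or_pos d with h0 | h0
    · simp [h0]
    · exact Nat.pow_le_pow_right h0 (by norm_num)
  set Y := 44 * (d ^ 3 * (κ + 1)) with hY
  have e1 : 11 * d ^ 2 + Y < I := by nlinarith [Nat.zero_le (d ^ 3 * κ)]
  have e2 : M'.card * (M.card ^ 2 * k) ≤ Y ^ 2 := by
    calc M'.card * (M.card ^ 2 * k) ≤ (11 * d ^ 2) * ((11 * d ^ 2) ^ 2 * κ ^ 2) := by gcongr
      _ = 1331 * (d ^ 6 * κ ^ 2) := by ring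
      _ ≤ 1936 * (d ^ 6 * (κ + 1) ^ 2) := by gcongr <;> omega
      _ = Y ^ 2 := by rw [hY]; ring
  have e3 : I * I ≤ 11 * d ^ 2 * I + Y ^ 2 := by
    nlinarith [Nat.mul_le_mul_right I c2]
  nlinarith

theorem meets_le_of_ne_zero (hk : k ≤ κ ^ 2) (f : MvPolynomial (Fin 3) K) (hf : f ≠ 0)
    (hp : f.totalDegree < p) : ∀ L L' : Finset (NLine K), TransversalFamilies k L L' →
    (∀ l ∈ L, l.restrict f = 0) → (∀ w ∈ L', w.restrict f = 0) →
    meets L L' ≤ (5 * f.totalDegree + k) * (L.card + L'.card) +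
      55 * (f.totalDegree ^ 3 * (κ + 1)) := by
  induction f using WfDvdMonoid.induction_on_irreducible with
  | zero => exact absurd rfl hf
  | unit u hu =>
    intro L L' _ hL _
    have : L = ∅ := by
      refine Finset.eq_empty_of_forall_notMem fun l hl => ?_
      have h1 := hu.map l.restrict
      rw [hL l hl] at h1
      exact not_isUnit_zero h1
    subst this
    simp [meets, incid]
  | mul g π hg hπ ih =>
    intro L L' h hL hL'
    have hdeg := MvPolynomial.totalDegree_mul_of_isDomain hπ.ne_zero hg
    rw [hdeg] at hp ⊢
    set L₁ := L.filter fun l => l.restrict π = 0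
    set L₂ := L.filter fun l => ¬ l.restrict π = 0
    set M₁ := L'.filter fun l => l.restrict π = 0
    set M₂ := L'.filter fun l => ¬ l.restrict π = 0
    have hL₁ : ∀ l ∈ L₁, l.restrict π = 0 := fun l hl => (Finset.mem_filter.1 hl).2
    have hM₁ : ∀ l ∈ M₁, l.restrict π = 0 := fun l hl => (Finset.mem_filter.1 hl).2
    have hL₂ : ∀ l ∈ L₂, l.restrict π ≠ 0 := fun l hl => (Finset.mem_filter.1 hl).2
    have hM₂ : ∀ l ∈ M₂, l.restrict π ≠ 0 := fun l hl => (Finset.mem_filter.1 hl).2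
    have s1 : L₁ ⊆ L := Finset.filter_subset _ _
    have s2 : L₂ ⊆ L := Finset.filter_subset _ _
    have s3 : M₁ ⊆ L' := Finset.filter_subset _ _
    have s4 : M₂ ⊆ L' := Finset.filter_subset _ _
    have hL₂g : ∀ l ∈ L₂, l.restrict g = 0 := fun l hl => by
      have := hL l (s2 hl)
      rw [map_mul] at this
      exact (mul_eq_zero.1 this).resolve_left (hL₂ l hl)
    have hM₂g : ∀ l ∈ M₂, l.restrict g = 0 := fun l hl => by
      have := hL' l (s4 hl)
      rw [map_mul] at this
      exact (mul_eq_zero.1 this).resolve_left (hM₂ l hl)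
    have i1 := (h.mono s1 s3).meets_le_of_irreducible hk hπ (by omega) hL₁ hM₁
    have i2 := ih hg (by omega) L₂ M₂ (h.mono s2 s4) hL₂g hM₂g
    have i3 := (h.mono s2 s3).meets_le_of_not_restrict π hL₂ hM₁
    have i4 := (h.mono s1 s4).symm.meets_le_of_not_restrict π hM₂ hL₁
    rw [meets_comm] at i4
    have e1 : meets L L' = meets L₁ M₁ + meets L₁ M₂ + (meets L₂ M₁ + meets L₂ M₂) := by
      rw [meets, incid_filter_left _ L L' (fun l => l.restrict π = 0),
        incid_filter_right _ _ L' (fun l => l.restrict π = 0),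
        incid_filter_right _ (L.filter fun l => ¬ l.restrict π = 0) L' (fun l => l.restrict π = 0)]
    have c1 : L₁.card + L₂.card = L.card := Finset.card_filter_add_card_filter_not _
    have c2 : M₁.card + M₂.card = L'.card := Finset.card_filter_add_card_filter_not _
    rw [e1, ← c1, ← c2]
    set a := π.totalDegree
    set b := g.totalDegree
    have e2 : a ^ 3 + b ^ 3 ≤ (a + b) ^ 3 := by nlinarith [Nat.zero_le (a ^ 2 * b), Nat.zero_le (a * b ^ 2)]
    have e3 := Nat.mul_le_mul_right (κ + 1) e2
    nlinarith [Nat.zero_le (a * L₁.card), Nat.zero_le (a * M₁.card), Nat.zero_le (b * L₁.card),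
      Nat.zero_le (b * M₁.card), Nat.zero_le (a * L₂.card), Nat.zero_le (a * M₂.card)]

end TransversalFamilies

/-- A set of at most `3 j²` isotropic lines lies on a surface of degree at most `9 j`. -/
theorem exists_vanishing (j : ℕ) (hj : 0 < j) (S : Finset (NLine K)) (hS : S.card ≤ 3 * j ^ 2) :
    ∃ f : MvPolynomial (Fin 3) K, f ≠ 0 ∧ f.totalDegree ≤ 9 * j ∧ ∀ l ∈ S, l.restrict f = 0 := by
  let mon : (Fin 3 → Fin (3 * j)) → (Fin 3 →₀ ℕ) := fun m =>
    Finsupp.equivFunOnFinite.symm fun i => (m i : ℕ)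
  have hmon : Function.Injective mon := by
    intro m m' h
    funext i
    have := DFunLike.congr_fun h i
    exact Fin.ext this
  let Φ : ((Fin 3 → Fin (3 * j)) → K) →ₗ[K] MvPolynomial (Fin 3) K :=
    ∑ m, (MvPolynomial.monomial (mon m)).comp (LinearMap.proj m)
  have hΦ : ∀ a, Φ a = ∑ m, MvPolynomial.monomial (mon m) (a m) := fun a => by simp [Φ]
  have hcoeff : ∀ a m, (Φ a).coeff (mon m) = a m := by
    intro a m
    rw [hΦ, MvPolynomial.coeff_sum]
    simp [MvPolynomial.coeff_monomial, hmon.eq_iff]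
  have hdeg : ∀ a, (Φ a).totalDegree ≤ 9 * j - 3 := by
    intro a
    rw [hΦ]
    refine MvPolynomial.totalDegree_finsetSum_le fun m _ => ?_
    refine (MvPolynomial.totalDegree_monomial_le _ _).trans ?_
    rw [Finsupp.sum_fintype _ _ (fun _ => rfl), Fin.sum_univ_three]
    have h0 := (m 0).2
    have h1 := (m 1).2
    have h2 := (m 2).2
    simp only [mon, Finsupp.equivFunOnFinite_symm_apply_apply, id]
    omega
  let Ψ : ((Fin 3 → Fin (3 * j)) → K) →ₗ[K] (S × Fin (9 * j - 2) → K) :=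
    LinearMap.pi fun q => (Polynomial.lcoeff K q.2).comp ((q.1.1.restrict.toLinearMap).comp Φ)
  have hker : LinearMap.ker Ψ ≠ ⊥ := by
    refine LinearMap.ker_ne_bot_of_finrank_lt ?_
    simp only [Module.finrank_fintype_fun_eq_card, Fintype.card_prod, Fintype.card_fin,
      Fintype.card_coe, Fintype.card_fun]
    calc S.card * (9 * j - 2) ≤ 3 * j ^ 2 * (9 * j - 2) := Nat.mul_le_mul_right _ hS
      _ < 3 * j ^ 2 * (9 * j) := by
        refine Nat.mul_lt_mul_of_pos_left (by omega) (by positivity)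
      _ = (3 * j) ^ 3 := by ring
  obtain ⟨a, ha, ha0⟩ := Submodule.exists_mem_ne_zero_of_ne_bot hker
  refine ⟨Φ a, ?_, (hdeg a).trans (Nat.sub_le _ _), fun l hl => ?_⟩
  · intro h
    refine ha0 (funext fun m => ?_)
    rw [← hcoeff a m, h]
    simp
  · ext i
    by_cases hi : i < 9 * j - 2
    · have := congrFun (LinearMap.mem_ker.1 ha) (⟨l, hl⟩, ⟨i, hi⟩)
      simpa [Ψ] using this
    · rw [Polynomial.coeff_eq_zero_of_natDegree_lt, Polynomial.coeff_zero]
      have h1 := l.natDegree_restrict_le (Φ a)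
      have h2 := hdeg a
      omega

/-- The incidence bound, by splitting one family into blocks lying on surfaces of small degree. -/
theorem TransversalFamilies.meets_le {p : ℕ} [CharP K p] [Infinite K] {k κ j : ℕ}
    (hk : k ≤ κ ^ 2) (hj : 0 < j) (hp : 9 * j < p) (m : ℕ) (N : ℕ) :
    ∀ L L' : Finset (NLine K), TransversalFamilies k L L' → L'.card ≤ m →
      L.card ≤ N * (3 * j ^ 2) →
      meets L L' ≤ N * ((54 * j + k) * (3 * j ^ 2 + m) + 55 * ((9 * j) ^ 3 * (κ + 1))) := by
  induction N with
  | zero =>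
    intro L L' _ _ hL
    have : L = ∅ := Finset.card_eq_zero.1 (by omega)
    subst this
    simp [meets, incid]
  | succ N ih =>
    intro L L' h hm hL
    obtain ⟨S, hSL, hS⟩ : ∃ S ⊆ L, S.card = min L.card (3 * j ^ 2) :=
      Finset.exists_subset_card_eq (min_le_left _ _)
    obtain ⟨f, hf0, hfd, hf⟩ := exists_vanishing j hj S (by omega)
    have hrest : (L \ S).card ≤ N * (3 * j ^ 2) := by
      have h1 := Finset.card_sdiff_add_card_eq_card hSL
      rw [add_mul, one_mul] at hL
      omega
    have i1 := ih (L \ S) L' (h.mono Finset.sdiff_subset le_rfl) hm hrest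
    have i2 : meets L L' = meets (L \ S) L' + meets S L' := (Finset.sum_sdiff hSL).symm
    set M₁ := L'.filter fun l => l.restrict f = 0
    set M₂ := L'.filter fun l => ¬ l.restrict f = 0
    have s3 : M₁ ⊆ L' := Finset.filter_subset _ _
    have s4 : M₂ ⊆ L' := Finset.filter_subset _ _
    have i3 : meets S L' = meets S M₁ + meets S M₂ := incid_filter_right _ _ _ _
    have i4 := meets_le_of_ne_zero (p := p) hk f hf0 (by omega) S M₁ (h.mono hSL s3) hf
      (fun w hw => (Finset.mem_filter.1 hw).2)
    have i5 := (h.mono hSL s4).symm.meets_le_of_not_restrict f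
      (fun w hw => (Finset.mem_filter.1 hw).2) hf
    rw [meets_comm] at i5
    have c1 : M₁.card ≤ m := (Finset.card_le_card s3).trans hm
    have c2 : M₂.card ≤ m := (Finset.card_le_card s4).trans hm
    have c3 : S.card ≤ 3 * j ^ 2 := by omega
    have b4 : meets S M₁ ≤ (45 * j + k) * (3 * j ^ 2 + m) + 55 * ((9 * j) ^ 3 * (κ + 1)) := by
      have : 5 * f.totalDegree + k ≤ 45 * j + k := by omega
      refine i4.trans ?_
      gcongr
    have b5 : meets S M₂ ≤ 9 * j * (3 * j ^ 2 + m) := by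
      refine i5.trans ?_
      gcongr
      omega
    rw [i2, i3, add_mul N 1, one_mul]
    refine add_le_add i1 ?_
    calc _ ≤ _ := add_le_add b4 b5
      _ = _ := by ring

end Families

section SplitForm

variable {K : Type*} [Field K]

open scoped Classical

/-- The quadratic form `u v` evaluated at a difference. -/
def splitDist (a b : K × K) : K := (a.1 - b.1) * (a.2 - b.2)

/-- The distances of a finite set for the quadratic form `u v`. -/
noncomputable def splitDistSet (A : Finset (K × K)) : Finset K :=
  (A ×ˢ A).image fun q => splitDist q.1 q.2

/-- Both coordinates are injective on `A`: no two points are at distance zero. -/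
def Anisotropic (A : Finset (K × K)) : Prop :=
  Set.InjOn Prod.fst (A : Set (K × K)) ∧ Set.InjOn Prod.snd (A : Set (K × K))

/-- For two segments of equal nonzero length: they are mirror images of each other. -/
def Axial (q q' : (K × K) × (K × K)) : Prop :=
  (q.2.1 - q.1.1) * (q.1.2 - q'.1.2) + (q'.2.2 - q'.1.2) * (q.1.1 - q'.1.1) = 0

/-- The segments with endpoints in `A` of length `r`. -/
noncomputable def segments (A : Finset (K × K)) (r : K) : Finset ((K × K) × (K × K)) :=
  (A ×ˢ A).filter fun q => splitDist q.1 q.2 = r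

variable {A : Finset (K × K)} {r : K}

theorem mem_segments {q : (K × K) × (K × K)} :
    q ∈ segments A r ↔ (q.1 ∈ A ∧ q.2 ∈ A) ∧ (q.2.1 - q.1.1) * (q.2.2 - q.1.2) = r := by
  rw [segments, Finset.mem_filter, Finset.mem_product, splitDist]
  rw [show (q.1.1 - q.2.1) * (q.1.2 - q.2.2) = (q.2.1 - q.1.1) * (q.2.2 - q.1.2) by ring]

theorem splitDist_mem {a b : K × K} (ha : a ∈ A) (hb : b ∈ A) : splitDist a b ∈ splitDistSet A :=
  Finset.mem_image.2 ⟨(a, b), Finset.mem_product.2 ⟨ha, hb⟩, rfl⟩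

theorem Anisotropic.eq_of_splitDist_eq_zero (hA : Anisotropic A) {a b : K × K} (ha : a ∈ A)
    (hb : b ∈ A) (h : splitDist a b = 0) : a = b := by
  rcases mul_eq_zero.1 h with h | h
  · exact hA.1 ha hb (sub_eq_zero.1 h)
  · exact hA.2 ha hb (sub_eq_zero.1 h)

theorem card_le_two_of_quadratic {S : Finset K} {a b c : K} (h0 : a ≠ 0 ∨ b ≠ 0)
    (h : ∀ x ∈ S, a * x ^ 2 + b * x + c = 0) : S.card ≤ 2 := by
  set P : Polynomial K := Polynomial.C a * Polynomial.X ^ 2 + Polynomial.C b * Polynomial.X +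
    Polynomial.C c with hP
  have hP0 : P ≠ 0 := by
    intro h
    have h1 := congrArg (fun Q => Polynomial.coeff Q 1) h
    have h2 := congrArg (fun Q => Polynomial.coeff Q 2) h
    simp [hP, Polynomial.coeff_C] at h1 h2
    tauto
  have hdeg : P.natDegree ≤ 2 := Polynomial.natDegree_quadratic_le
  have hsub : S ⊆ P.roots.toFinset := fun x hx => by
    rw [Multiset.mem_toFinset, Polynomial.mem_roots hP0]
    simpa [hP] using h x hx
  exact (Finset.card_le_card hsub).trans ((Multiset.toFinset_card_le _).trans
    ((Polynomial.card_roots' _).trans hdeg))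

/-- A subset of `A` on which the distance to a fixed point determines the first coordinate up to
two choices has at most `2 |Δ(A)|` elements. -/
theorem Anisotropic.card_le_of_quadratic (hA : Anisotropic A) {S : Finset (K × K)} (hS : S ⊆ A)
    (h : ∀ x₀ ∈ S, ∃ α μ ν : K, (μ ≠ 0 ∨ α ≠ 0) ∧ ∀ x ∈ S,
      μ * (x.1 - x₀.1) ^ 2 + α * splitDist x x₀ * (x.1 - x₀.1) + ν * splitDist x x₀ = 0) :
    S.card ≤ 2 * (splitDistSet A).card := by
  rcases S.eq_empty_or_nonempty with rfl | ⟨x₀, hx₀⟩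
  · simp
  obtain ⟨α, μ, ν, h0, h1⟩ := h x₀ hx₀
  refine Finset.card_le_mul_card_image_of_maps_to (f := fun x => splitDist x x₀)
    (fun x hx => splitDist_mem (hS hx) (hS hx₀)) 2 fun t _ => ?_
  by_cases ht : t = 0
  · refine (Finset.card_le_one.2 fun x hx y hy => ?_).trans one_le_two
    obtain ⟨hx1, hx2⟩ := Finset.mem_filter.1 hx
    obtain ⟨hy1, hy2⟩ := Finset.mem_filter.1 hy
    rw [hA.eq_of_splitDist_eq_zero (hS hx1) (hS hx₀) (hx2.trans ht),
      hA.eq_of_splitDist_eq_zero (hS hy1) (hS hx₀) (hy2.trans ht)]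
  · rw [← Finset.card_image_of_injOn (f := fun x : K × K => x.1 - x₀.1)]
    · refine card_le_two_of_quadratic (a := μ) (b := α * t) (c := ν * t) ?_ fun y hy => ?_
      · exact h0.imp_right fun h => mul_ne_zero h ht
      · obtain ⟨x, hx, rfl⟩ := Finset.mem_image.1 hy
        obtain ⟨hx1, hx2⟩ := Finset.mem_filter.1 hx
        have := h1 x hx1
        rwa [hx2] at this
    · intro x hx y hy hxy
      exact hA.1 (hS (Finset.mem_filter.1 hx).1) (hS (Finset.mem_filter.1 hy).1)
        (sub_left_injective hxy)

/-- Few points lie on a circle of nonzero radius centred anywhere. -/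
theorem Anisotropic.card_circle_le (hA : Anisotropic A) (hr : r ≠ 0) (c : K × K) :
    (A.filter fun x => (x.1 - c.1) * (x.2 - c.2) = r).card ≤ 2 * (splitDistSet A).card := by
  refine hA.card_le_of_quadratic (Finset.filter_subset _ _) fun x₀ hx₀ => ?_
  have h0 := (Finset.mem_filter.1 hx₀).2
  have hx₀1 : x₀.1 - c.1 ≠ 0 := left_ne_zero_of_mul (h0.trans_ne hr)
  refine ⟨x₀.1 - c.1, r, (x₀.1 - c.1) ^ 2, Or.inl hr, fun x hx => ?_⟩
  have h1 := (Finset.mem_filter.1 hx).2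
  simp only [splitDist]
  linear_combination (x.1 - x₀.1) * (x₀.1 - c.1) * h1 - (x.1 - x₀.1) * (x.1 - c.1) * h0

theorem Anisotropic.card_segments_le (hA : Anisotropic A) (hr : r ≠ 0) :
    (segments A r).card ≤ 2 * (splitDistSet A).card * A.card := by
  refine Finset.card_le_mul_card_image_of_maps_to (f := Prod.fst)
    (fun q hq => (mem_segments.1 hq).1.1) _ fun c _ => ?_
  refine le_trans ?_ (hA.card_circle_le hr c)
  refine Finset.card_le_card_of_injOn Prod.snd (fun q hq => ?_) fun q hq q' hq' h => ?_
  · obtain ⟨h1, h2⟩ := Finset.mem_filter.1 hq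
    obtain ⟨h3, h4⟩ := mem_segments.1 h1
    rw [h2] at h4
    exact Finset.mem_coe.2 (Finset.mem_filter.2 ⟨h3.2, h4⟩)
  · exact Prod.ext ((Finset.mem_filter.1 hq).2.trans (Finset.mem_filter.1 hq').2.symm) h

theorem Axial.symm {q q' : (K × K) × (K × K)} (hr : r ≠ 0) (hq : q ∈ segments A r)
    (hq' : q' ∈ segments A r) (h : Axial q q') : Axial q' q := by
  have h1 := (mem_segments.1 hq).2
  have h2 := (mem_segments.1 hq').2
  apply mul_left_cancel₀ hr
  simp only [Axial] at h ⊢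
  linear_combination (-(q.2.2 - q.1.2) * (q'.2.1 - q'.1.1)) * h +
    ((q'.2.1 - q'.1.1) * (q.1.2 - q'.1.2)) * h1 + ((q.2.2 - q.1.2) * (q.1.1 - q'.1.1)) * h2

theorem Anisotropic.ext_segments (hA : Anisotropic A) {q q' : (K × K) × (K × K)}
    (hq : q ∈ segments A r) (hq' : q' ∈ segments A r) (h1 : q.1 = q'.1)
    (h2 : q.2.1 - q.1.1 = q'.2.1 - q'.1.1) : q = q' := by
  refine Prod.ext h1 (hA.1 (mem_segments.1 hq).1.2 (mem_segments.1 hq').1.2 ?_)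
  rw [h1] at h2
  exact sub_left_injective h2

theorem Anisotropic.ext_segments' (hA : Anisotropic A) {q q' : (K × K) × (K × K)}
    (hq : q ∈ segments A r) (hq' : q' ∈ segments A r) (h1 : q.1 = q'.1)
    (h2 : q.2.2 - q.1.2 = q'.2.2 - q'.1.2) : q = q' := by
  refine Prod.ext h1 (hA.2 (mem_segments.1 hq).1.2 (mem_segments.1 hq').1.2 ?_)
  rw [h1] at h2
  exact sub_left_injective h2

/-- Two distinct segments have few common mirror images. -/
theorem Anisotropic.card_common_axial_le (hA : Anisotropic A) (hr : r ≠ 0)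
    {s₁ s₂ : (K × K) × (K × K)} (hs₁ : s₁ ∈ segments A r) (hs₂ : s₂ ∈ segments A r)
    (hne : s₁ ≠ s₂) :
    ((segments A r).filter fun q => Axial q s₁ ∧ Axial q s₂).card ≤
      2 * (splitDistSet A).card := by
  obtain ⟨⟨m1, m1'⟩, n1⟩ := mem_segments.1 hs₁
  obtain ⟨⟨m2, m2'⟩, n2⟩ := mem_segments.1 hs₂
  have z1 : s₁.2.2 - s₁.1.2 ≠ 0 := right_ne_zero_of_mul (n1.trans_ne hr)
  by_cases hc : s₁.1 = s₂.1
  · refine le_trans ?_ (hA.card_circle_le hr s₁.1)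
    have hfst : ∀ q ∈ (segments A r).filter fun q => Axial q s₁ ∧ Axial q s₂, q.1 = s₁.1 := by
      intro q hq
      obtain ⟨hq1, e1, e2⟩ := Finset.mem_filter.1 hq
      refine hA.1 (mem_segments.1 hq1).1.1 m1 (sub_eq_zero.1 ?_)
      have hσ : (s₁.2.2 - s₁.1.2) - (s₂.2.2 - s₂.1.2) ≠ 0 := fun h =>
        hne (hA.ext_segments' hs₁ hs₂ hc (sub_eq_zero.1 h))
      apply mul_left_cancel₀ hσ
      simp only [Axial, ← hc] at e1 e2
      rw [← hc]
      linear_combination e1 - e2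
    refine Finset.card_le_card_of_injOn Prod.snd (fun q hq => ?_) fun q hq q' hq' h => ?_
    · have h1 := hfst q hq
      obtain ⟨h3, h4⟩ := mem_segments.1 (Finset.mem_filter.1 hq).1
      rw [h1] at h4
      exact Finset.mem_coe.2 (Finset.mem_filter.2 ⟨h3.2, h4⟩)
    · exact Prod.ext ((hfst q hq).trans (hfst q' hq').symm) h
  · have hc2 : s₁.1.2 - s₂.1.2 ≠ 0 := fun h => hc (hA.2 m1 m2 (sub_eq_zero.1 h))
    rw [← Finset.card_image_of_injOn (f := Prod.fst)]
    · refine hA.card_le_of_quadratic (fun b hb => ?_) fun b₀ hb₀ => ?_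
      · obtain ⟨q, hq, rfl⟩ := Finset.mem_image.1 hb
        exact (mem_segments.1 (Finset.mem_filter.1 hq).1).1.1
      · have key : ∀ b ∈ ((segments A r).filter fun q => Axial q s₁ ∧ Axial q s₂).image Prod.fst,
            (s₁.2.2 - s₁.1.2) * (b.1 - s₁.1.1) * (b.2 - s₂.1.2) =
              (s₂.2.2 - s₂.1.2) * (b.1 - s₂.1.1) * (b.2 - s₁.1.2) := by
          intro b hb
          obtain ⟨q, hq, rfl⟩ := Finset.mem_image.1 hb
          obtain ⟨-, e1, e2⟩ := Finset.mem_filter.1 hq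
          simp only [Axial] at e1 e2
          linear_combination (q.1.2 - s₂.1.2) * e1 - (q.1.2 - s₁.1.2) * e2
        refine ⟨(s₁.2.2 - s₁.1.2) - (s₂.2.2 - s₂.1.2),
          (s₁.2.2 - s₁.1.2) * (b₀.2 - s₂.1.2) - (s₂.2.2 - s₂.1.2) * (b₀.2 - s₁.1.2),
          (s₁.2.2 - s₁.1.2) * (b₀.1 - s₁.1.1) - (s₂.2.2 - s₂.1.2) * (b₀.1 - s₂.1.1), ?_,
          fun b hb => ?_⟩
        · by_cases hα : (s₁.2.2 - s₁.1.2) - (s₂.2.2 - s₂.1.2) = 0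
          · left
            rw [← sub_eq_zero.1 hα, ← mul_sub]
            refine mul_ne_zero z1 fun h => hc2 ?_
            linear_combination h
          · exact Or.inr hα
        · have k0 := key b₀ hb₀
          have k1 := key b hb
          simp only [splitDist]
          linear_combination (b.1 - b₀.1) * (k1 - k0)
    · intro q hq q' hq' h
      obtain ⟨hq1, e1, e2⟩ := Finset.mem_filter.1 hq
      obtain ⟨hq1', e1', e2'⟩ := Finset.mem_filter.1 hq'
      refine hA.ext_segments hq1 hq1' h ?_
      simp only [Axial, ← h] at e1 e2 e1' e2'
      rw [← h]
      apply mul_left_cancel₀ hc2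
      linear_combination e2 - e1 - e2' + e1'

end SplitForm

section Lifting

variable {K : Type*} [Field K]

open scoped Classical

open Filter

theorem eventually_quadratic_ne_zero {a b c : K} (h : ¬ (a = 0 ∧ b = 0 ∧ c = 0)) :
    ∀ᶠ d in cofinite, a * d ^ 2 + b * d + c ≠ 0 := by
  set P : Polynomial K := Polynomial.C a * Polynomial.X ^ 2 + Polynomial.C b * Polynomial.X +
    Polynomial.C c with hP
  have hP0 : P ≠ 0 := by
    intro h'
    have h0 := congrArg (fun Q => Polynomial.coeff Q 0) h'
    have h1 := congrArg (fun Q => Polynomial.coeff Q 1) h'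
    have h2 := congrArg (fun Q => Polynomial.coeff Q 2) h'
    simp [hP, Polynomial.coeff_C] at h0 h1 h2
    tauto
  refine (P.roots.toFinset.finite_toSet).subset fun d hd => ?_
  have hd' : a * d ^ 2 + b * d + c = 0 := not_not.1 hd
  rw [Finset.mem_coe, Multiset.mem_toFinset, Polynomial.mem_roots hP0]
  simpa [hP] using hd'

/-- The line attached to a segment, as the first member of an axial pair. -/
def leftLine (d : K) (q : (K × K) × (K × K)) : NLine K where
  s := q.2.1 - q.1.1
  b := q.1.1
  c := d * (q.2.1 - q.1.1) * (q.1.2 + d) - (q.2.1 - q.1.1) * q.1.1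

/-- The line attached to a segment, as the second member of an axial pair. -/
def rightLine (d : K) (q : (K × K) × (K × K)) : NLine K where
  s := d * (q.2.2 - q.1.2)
  b := d * (q.1.2 + d)
  c := d * (q.2.2 - q.1.2) * q.1.1 - d * (q.2.2 - q.1.2) * (d * (q.1.2 + d))

theorem form_leftLine_rightLine {d : K} (hd : d ≠ 0) (q q' : (K × K) × (K × K)) :
    (leftLine d q).form (rightLine d q') = 0 ↔ Axial q q' := by
  have : (leftLine d q).form (rightLine d q') = d * ((q.2.1 - q.1.1) * (q.1.2 - q'.1.2) +
      (q'.2.2 - q'.1.2) * (q.1.1 - q'.1.1)) := by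
    simp only [NLine.form, leftLine, rightLine]
    ring
  rw [this, mul_eq_zero, or_iff_right hd, Axial]

variable {A : Finset (K × K)} {r : K}

theorem Anisotropic.exists_transversalFamilies [Infinite K] (hA : Anisotropic A) (hr : r ≠ 0) :
    ∃ d : K, d ≠ 0 ∧ Set.InjOn (leftLine d) (segments A r : Set ((K × K) × (K × K))) ∧
      Set.InjOn (rightLine d) (segments A r : Set ((K × K) × (K × K))) ∧
      TransversalFamilies (2 * (splitDistSet A).card) ((segments A r).image (leftLine d))
        ((segments A r).image (rightLine d)) := by
  set S := segments A r with hS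
  have nz : ∀ q ∈ S, q.2.1 - q.1.1 ≠ 0 ∧ q.2.2 - q.1.2 ≠ 0 := fun q hq => by
    have := (mem_segments.1 hq).2
    exact ⟨left_ne_zero_of_mul (this.trans_ne hr), right_ne_zero_of_mul (this.trans_ne hr)⟩
  have g0 : ∀ᶠ d : K in cofinite, d ≠ 0 := by
    simp [eventually_cofinite]
  have g1 : ∀ᶠ d : K in cofinite, ∀ q ∈ S, ∀ q' ∈ S,
      q.2.1 - q.1.1 ≠ d * (q'.2.2 - q'.1.2) := by
    refine (eventually_all_finset S).2 fun q hq => (eventually_all_finset S).2 fun q' _ => ?_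
    filter_upwards [eventually_quadratic_ne_zero (a := 0) (b := -(q'.2.2 - q'.1.2))
      (c := q.2.1 - q.1.1) fun h => (nz q hq).1 h.2.2] with d hd h
    exact hd (by linear_combination h)
  have g2 : ∀ᶠ d : K in cofinite, ∀ q ∈ S, ∀ q' ∈ S, q ≠ q' →
      (leftLine d q).form (leftLine d q') ≠ 0 := by
    refine (eventually_all_finset S).2 fun q hq => (eventually_all_finset S).2 fun q' hq' => ?_
    by_cases hne : q = q'
    · simp [hne]
    have hq0 := eventually_quadratic_ne_zero
      (a := (q.2.1 - q.1.1) - (q'.2.1 - q'.1.1))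
      (b := (q.2.1 - q.1.1) * q.1.2 - (q'.2.1 - q'.1.1) * q'.1.2)
      (c := (q'.2.1 - q'.1.1) * q.1.1 - (q.2.1 - q.1.1) * q'.1.1) <| by
        rintro ⟨h1, h2, -⟩
        refine hne (hA.ext_segments hq hq' (hA.2 (mem_segments.1 hq).1.1
          (mem_segments.1 hq').1.1 ?_) (sub_eq_zero.1 h1))
        apply mul_left_cancel₀ (nz q hq).1
        linear_combination h2 - q'.1.2 * h1
    filter_upwards [hq0] with d hd _ h
    refine hd ?_
    simp only [NLine.form, leftLine] at h
    linear_combination h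
  have g3 : ∀ᶠ d : K in cofinite, ∀ q ∈ S, ∀ q' ∈ S, q ≠ q' →
      (rightLine d q).form (rightLine d q') ≠ 0 := by
    refine (eventually_all_finset S).2 fun q hq => (eventually_all_finset S).2 fun q' hq' => ?_
    by_cases hne : q = q'
    · simp [hne]
    have hq0 := eventually_quadratic_ne_zero
      (a := (q'.2.2 - q'.1.2) - (q.2.2 - q.1.2))
      (b := (q'.2.2 - q'.1.2) * q.1.2 - (q.2.2 - q.1.2) * q'.1.2)
      (c := (q.2.2 - q.1.2) * q.1.1 - (q'.2.2 - q'.1.2) * q'.1.1) <| by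
        rintro ⟨h1, -, h3⟩
        refine hne (hA.ext_segments' hq hq' (hA.1 (mem_segments.1 hq).1.1
          (mem_segments.1 hq').1.1 ?_) (sub_eq_zero.1 h1).symm)
        apply mul_left_cancel₀ (nz q hq).2
        linear_combination h3 + q'.1.1 * h1
    filter_upwards [g0, hq0] with d hd0 hd _ h
    refine hd (mul_left_cancel₀ hd0 ?_)
    simp only [NLine.form, rightLine] at h
    linear_combination h
  obtain ⟨d, d0, d1, d2, d3⟩ := (g0.and (g1.and (g2.and g3))).exists
  have inj : ∀ q ∈ S, ∀ q' ∈ S, q.2.1 - q.1.1 = q'.2.1 - q'.1.1 → q.1.1 = q'.1.1 → q = q' :=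
    fun q hq q' hq' h1 h2 => hA.ext_segments hq hq'
      (hA.1 (mem_segments.1 hq).1.1 (mem_segments.1 hq').1.1 h2) h1
  have inj' : ∀ q ∈ S, ∀ q' ∈ S, d * (q.2.2 - q.1.2) = d * (q'.2.2 - q'.1.2) →
      d * (q.1.2 + d) = d * (q'.1.2 + d) → q = q' :=
    fun q hq q' hq' h1 h2 => hA.ext_segments' hq hq'
      (hA.2 (mem_segments.1 hq).1.1 (mem_segments.1 hq').1.1
        (add_left_injective d (mul_left_cancel₀ d0 h2))) (mul_left_cancel₀ d0 h1)
  have i1 : Set.InjOn (leftLine d) (S : Set ((K × K) × (K × K))) := fun q hq q' hq' h =>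
    inj q hq q' hq' (congrArg NLine.s h) (congrArg NLine.b h)
  have i2 : Set.InjOn (rightLine d) (S : Set ((K × K) × (K × K))) := fun q hq q' hq' h =>
    inj' q hq q' hq' (congrArg NLine.s h) (congrArg NLine.b h)
  refine ⟨d, d0, i1, i2, ?_⟩
  constructor
  · simp only [Finset.mem_image]
    rintro _ ⟨q, hq, rfl⟩ _ ⟨q', hq', rfl⟩
    exact d1 q hq q' hq'
  · simp only [Finset.coe_image]
    rintro _ ⟨q, hq, rfl⟩ _ ⟨q', hq', rfl⟩ h
    rw [inj q hq q' hq' (Prod.ext_iff.1 h).1 (Prod.ext_iff.1 h).2]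
  · simp only [Finset.coe_image]
    rintro _ ⟨q, hq, rfl⟩ _ ⟨q', hq', rfl⟩ h
    rw [inj' q hq q' hq' (Prod.ext_iff.1 h).1 (Prod.ext_iff.1 h).2]
  · simp only [Finset.mem_image]
    rintro _ ⟨q, hq, rfl⟩ _ ⟨q', hq', rfl⟩ h
    exact d2 q hq q' hq' fun h' => h (h' ▸ rfl)
  · simp only [Finset.mem_image]
    rintro _ ⟨q, hq, rfl⟩ _ ⟨q', hq', rfl⟩ h
    exact d3 q hq q' hq' fun h' => h (h' ▸ rfl)
  · simp only [Finset.mem_image]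
    rintro _ ⟨q, hq, rfl⟩ _ ⟨q', hq', rfl⟩ h
    rw [Finset.filter_image]
    simp only [form_leftLine_rightLine d0]
    refine Finset.card_image_le.trans (le_trans (Finset.card_le_card fun w hw => ?_)
      (hA.card_common_axial_le hr hq hq' fun h' => h (h' ▸ rfl)))
    obtain ⟨h1, h2, h3⟩ := Finset.mem_filter.1 hw
    exact Finset.mem_filter.2 ⟨h1, h2.symm hr hq h1, h3.symm hr hq' h1⟩
  · simp only [Finset.mem_image]
    rintro _ ⟨q, hq, rfl⟩ _ ⟨q', hq', rfl⟩ h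
    rw [Finset.filter_image]
    simp only [form_leftLine_rightLine d0]
    exact Finset.card_image_le.trans (hA.card_common_axial_le hr hq hq' fun h' => h (h' ▸ rfl))

/-- The number of axial pairs of segments of a given nonzero length. -/
theorem Anisotropic.card_axial_le {p : ℕ} [CharP K p] [Infinite K] (hA : Anisotropic A)
    (hr : r ≠ 0) {κ j : ℕ} (hk : 2 * (splitDistSet A).card ≤ κ ^ 2) (hj : 0 < j)
    (hp : 9 * j < p) :
    incid Axial (segments A r) (segments A r) ≤ ((segments A r).card / (3 * j ^ 2) + 1) *
      ((54 * j + 2 * (splitDistSet A).card) *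
        (3 * j ^ 2 + 2 * (splitDistSet A).card * A.card) + 55 * ((9 * j) ^ 3 * (κ + 1))) := by
  obtain ⟨d, d0, i1, i2, hT⟩ := hA.exists_transversalFamilies hr
  refine le_trans (le_of_eq ?_) (TransversalFamilies.meets_le hk hj hp _ _ _ _ hT
    (Finset.card_image_le.trans (hA.card_segments_le hr))
    (Finset.card_image_le.trans ?_))
  · rw [TransversalFamilies.meets, incid, incid, Finset.sum_image i1]
    refine Finset.sum_congr rfl fun q _ => ?_
    rw [Finset.filter_image, Finset.card_image_of_injOn (i2.mono (Finset.filter_subset _ _))]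
    simp only [form_leftLine_rightLine d0]
  · rw [mul_comm]
    exact (Nat.lt_mul_div_succ _ (by positivity)).le

end Lifting

section Bisectors

open scoped Classical

theorem card_sq_le_card_mul_card_collisions {α β : Type*} (s : Finset α) (t : Finset β)
    (f : α → β) (hf : ∀ a ∈ s, f a ∈ t) :
    s.card ^ 2 ≤ t.card * ((s ×ˢ s).filter fun q => f q.1 = f q.2).card := by
  have h1 : ((s ×ˢ s).filter fun q => f q.1 = f q.2).card =
      ∑ y ∈ t, (s.filter fun a => f a = y).card ^ 2 := by
    rw [Finset.card_eq_sum_card_fiberwise (f := fun q : α × α => f q.1) (t := t) fun q hq =>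
      hf _ (Finset.mem_product.1 (Finset.mem_filter.1 hq).1).1]
    refine Finset.sum_congr rfl fun y _ => ?_
    rw [sq, ← Finset.card_product]
    congr 1
    ext q
    simp only [Finset.mem_filter, Finset.mem_product]
    grind
  rw [h1, Finset.card_eq_sum_card_fiberwise hf]
  exact sq_sum_le_card_mul_sum_sq

theorem incid_eq_card {α β : Type*} (r : α → β → Prop) (s : Finset α) (t : Finset β) :
    incid r s t = ((s ×ˢ t).filter fun q => r q.1 q.2).card := by
  simp only [incid, Finset.card_filter, Finset.sum_product]

variable {K : Type*} [Field K]

/-- The coefficients `(α, β)` of the bisector `u + α v = β` of two points. -/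
def bisector (e : (K × K) × (K × K)) : K × K :=
  ((e.2.1 - e.1.1) / (e.2.2 - e.1.2), (e.2.1 * e.2.2 - e.1.1 * e.1.2) / (e.2.2 - e.1.2))

/-- The point `x` lies on the line `u + α v = β` with coefficients `l`. -/
def OnLine (x l : K × K) : Prop := x.1 + l.1 * x.2 = l.2

variable {A : Finset (K × K)}

theorem Anisotropic.snd_sub_ne_zero (hA : Anisotropic A) {e : (K × K) × (K × K)}
    (he : e ∈ A.offDiag) : e.2.2 - e.1.2 ≠ 0 := by
  obtain ⟨h1, h2, h3⟩ := Finset.mem_offDiag.1 he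
  exact fun h => h3 (hA.2 h1 h2 (sub_eq_zero.1 h).symm)

theorem Anisotropic.onLine_bisector (hA : Anisotropic A) {e : (K × K) × (K × K)}
    (he : e ∈ A.offDiag) (x : K × K) :
    OnLine x (bisector e) ↔ splitDist x e.1 = splitDist x e.2 := by
  have h := hA.snd_sub_ne_zero he
  simp only [OnLine, bisector, splitDist]
  constructor
  · intro h1
    field_simp at h1
    linear_combination h1
  · intro h1
    field_simp
    linear_combination h1

/-- Reflection in the bisector exchanges the two points. -/
theorem Anisotropic.bisector_reflects (hA : Anisotropic A) {e : (K × K) × (K × K)}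
    (he : e ∈ A.offDiag) :
    e.2.1 = (bisector e).2 - (bisector e).1 * e.1.2 ∧
      e.1.1 = (bisector e).2 - (bisector e).1 * e.2.2 := by
  have h := hA.snd_sub_ne_zero he
  simp only [bisector]
  constructor <;> (field_simp; ring)

theorem Anisotropic.card_lines_through_le_one (hA : Anisotropic A) (M : Finset (K × K))
    {e : (K × K) × (K × K)} (he : e ∈ A.offDiag) :
    (M.filter fun l => OnLine e.1 l ∧ OnLine e.2 l).card ≤ 1 := by
  refine Finset.card_le_one.2 fun l hl l' hl' => ?_
  obtain ⟨-, h1, h2⟩ := Finset.mem_filter.1 hl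
  obtain ⟨-, h1', h2'⟩ := Finset.mem_filter.1 hl'
  simp only [OnLine] at h1 h2 h1' h2'
  have h3 : l.1 = l'.1 := by
    apply mul_left_cancel₀ (hA.snd_sub_ne_zero he)
    linear_combination h2 - h1 - h2' + h1'
  refine Prod.ext h3 ?_
  rw [← h1, ← h1', h3]

/-- The incidences of `A` with the lines of `M` that contain at least two points of `A`. -/
theorem Anisotropic.sum_card_onLine_sq_le (hA : Anisotropic A) (M : Finset (K × K))
    (hM : ∀ l ∈ M, 1 < (A.filter fun x => OnLine x l).card) :
    ∑ l ∈ M, (A.filter fun x => OnLine x l).card ^ 2 ≤ 2 * A.card ^ 2 := by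
  have h1 : ∑ l ∈ M, (A.offDiag.filter fun e => OnLine e.1 l ∧ OnLine e.2 l).card ≤
      A.card ^ 2 := by
    have := incid_eq_sum_right (fun (e : (K × K) × (K × K)) l => OnLine e.1 l ∧ OnLine e.2 l)
      A.offDiag M
    rw [← this, incid]
    refine (Finset.sum_le_card_nsmul _ _ 1 fun e he => ?_).trans ?_
    · exact hA.card_lines_through_le_one M he
    · rw [smul_eq_mul, mul_one, Finset.offDiag_card, sq]
      exact Nat.sub_le _ _
  refine le_trans ?_ (Nat.mul_le_mul_left 2 h1)
  rw [Finset.mul_sum]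
  refine Finset.sum_le_sum fun l hl => ?_
  have h2 : A.offDiag.filter (fun e => OnLine e.1 l ∧ OnLine e.2 l) =
      (A.filter fun x => OnLine x l).offDiag := by
    ext e
    simp only [Finset.mem_filter, Finset.mem_offDiag]
    tauto
  have h3 := hM l hl
  rw [h2, Finset.offDiag_card]
  obtain ⟨n, hn⟩ := Nat.exists_eq_add_of_lt h3
  rw [hn, ← Nat.mul_pred]
  simp only [Nat.pred_eq_sub_one]
  rw [show 1 + n + 1 - 1 = n + 1 by omega]
  nlinarith

/-- Isosceles triangles in terms of pairs of pairs with a common bisector. -/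
theorem Anisotropic.incid_equidistant_le (hA : Anisotropic A) :
    ∃ U : ℕ, incid (fun x (e : (K × K) × (K × K)) => splitDist x e.1 = splitDist x e.2) A
        A.offDiag ≤ A.card ^ 2 + U ∧
      U ^ 2 ≤ 2 * A.card ^ 2 *
        ((A.offDiag ×ˢ A.offDiag).filter fun z => bisector z.1 = bisector z.2).card := by
  set i : K × K → ℕ := fun l => (A.filter fun x => OnLine x l).card with hi
  set P := A.offDiag with hP
  set Q := P.filter fun e => 1 < i (bisector e) with hQ
  refine ⟨∑ e ∈ Q, i (bisector e), ?_, ?_⟩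
  · rw [incid_eq_sum_right]
    have h1 : ∀ e ∈ P, (A.filter fun x => splitDist x e.1 = splitDist x e.2).card =
        i (bisector e) := fun e he => by
      simp only [hi, hA.onLine_bisector he]
    rw [Finset.sum_congr rfl h1, ← Finset.sum_filter_add_sum_filter_not P
      (fun e => 1 < i (bisector e)), add_comm]
    refine Nat.add_le_add_right ?_ _
    refine (Finset.sum_le_card_nsmul _ _ 1 fun e he => not_lt.1 (Finset.mem_filter.1 he).2).trans ?_
    rw [smul_eq_mul, mul_one]
    refine (Finset.card_filter_le _ _).trans ?_
    rw [Finset.offDiag_card, sq]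
    exact Nat.sub_le _ _
  · set M := Q.image bisector with hM
    have hmem : ∀ e ∈ Q, bisector e ∈ M := fun e he => Finset.mem_image_of_mem _ he
    have h1 : ∑ e ∈ Q, i (bisector e) =
        ∑ l ∈ M, (Q.filter fun e => bisector e = l).card * i l := by
      rw [← Finset.sum_fiberwise_of_maps_to hmem]
      refine Finset.sum_congr rfl fun l _ => ?_
      rw [Finset.sum_congr rfl (g := fun _ => i l) fun e he => by rw [(Finset.mem_filter.1 he).2],
        Finset.sum_const, smul_eq_mul]
    have h2 : ∑ l ∈ M, (Q.filter fun e => bisector e = l).card ^ 2 ≤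
        ((P ×ˢ P).filter fun z => bisector z.1 = bisector z.2).card := by
      simp only [sq, ← Finset.card_product]
      rw [Finset.card_eq_sum_card_fiberwise (f := fun z => bisector z.1) (t := P.image bisector)
        fun z hz => Finset.mem_image_of_mem _ (Finset.mem_product.1 (Finset.mem_filter.1 hz).1).1]
      refine (Finset.sum_le_sum fun l _ => Finset.card_le_card fun z hz => ?_).trans
        (Finset.sum_le_sum_of_subset (Finset.image_subset_image (Finset.filter_subset _ _)))
      simp only [Finset.mem_product, Finset.mem_filter, hQ] at hz ⊢
      grind
    have h3 : ∑ l ∈ M, i l ^ 2 ≤ 2 * A.card ^ 2 := by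
      refine hA.sum_card_onLine_sq_le M fun l hl => ?_
      obtain ⟨e, he, rfl⟩ := Finset.mem_image.1 hl
      exact (Finset.mem_filter.1 he).2
    rw [h1]
    refine (Finset.sum_mul_sq_le_sq_mul_sq _ _ _).trans ?_
    rw [mul_comm]
    exact Nat.mul_le_mul h3 h2

theorem card_cube_le (A : Finset (K × K)) :
    A.card ^ 3 ≤ (splitDistSet A).card *
      (incid (fun x (e : (K × K) × (K × K)) => splitDist x e.1 = splitDist x e.2) A A.offDiag +
        A.card ^ 2) := by
  have h1 : ∀ x ∈ A, A.card ^ 2 ≤ (splitDistSet A).card *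
      ((A.offDiag.filter fun e => splitDist x e.1 = splitDist x e.2).card + A.card) := by
    intro x hx
    refine (card_sq_le_card_mul_card_collisions A (splitDistSet A) (splitDist x)
      fun y hy => splitDist_mem hx hy).trans (Nat.mul_le_mul_left _ ?_)
    rw [← Finset.diag_union_offDiag, Finset.filter_union, add_comm]
    refine (Finset.card_union_le _ _).trans (Nat.add_le_add_right ?_ _)
    exact (Finset.card_filter_le _ _).trans_eq (Finset.diag_card A)
  have h2 := Finset.sum_le_sum h1
  rw [← Finset.mul_sum, Finset.sum_add_distrib, Finset.sum_const, Finset.sum_const, smul_eq_mul,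
    smul_eq_mul] at h2
  simp only [incid]
  nlinarith

/-- Pairs with a common bisector give axial pairs of segments. -/
theorem Anisotropic.card_common_bisector_le (hA : Anisotropic A) :
    ((A.offDiag ×ˢ A.offDiag).filter fun z => bisector z.1 = bisector z.2).card ≤
      A.card ^ 2 + ∑ r ∈ (splitDistSet A).erase 0, incid Axial (segments A r) (segments A r) := by
  set Z := (A.offDiag ×ˢ A.offDiag).filter fun z => bisector z.1 = bisector z.2 with hZ
  have key : ∀ z ∈ Z, ((z.1.1 ∈ A ∧ z.1.2 ∈ A) ∧ z.2.1 ∈ A ∧ z.2.2 ∈ A) ∧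
      splitDist z.1.1 z.2.1 = splitDist z.1.2 z.2.2 ∧
      Axial (z.1.1, z.2.1) (z.1.2, z.2.2) := by
    intro z hz
    obtain ⟨h1, h2⟩ := Finset.mem_filter.1 hz
    obtain ⟨h3, h4⟩ := Finset.mem_product.1 h1
    obtain ⟨a1, a2, -⟩ := Finset.mem_offDiag.1 h3
    obtain ⟨a3, a4, -⟩ := Finset.mem_offDiag.1 h4
    obtain ⟨r1, r2⟩ := hA.bisector_reflects h3
    obtain ⟨r3, r4⟩ := hA.bisector_reflects h4
    rw [← h2] at r3 r4
    refine ⟨⟨⟨a1, a2⟩, a3, a4⟩, ?_, ?_⟩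
    · simp only [splitDist]
      linear_combination (z.1.1.2 - z.2.1.2) * (r2 - r4) - (z.1.2.2 - z.2.2.2) * (r1 - r3)
    · simp only [Axial]
      linear_combination (z.1.1.2 - z.1.2.2) * (r4 - r2) + (z.2.2.2 - z.1.2.2) * (r2 - r1)
  rw [← Finset.card_filter_add_card_filter_not (s := Z) fun z => splitDist z.1.1 z.2.1 = 0]
  refine add_le_add ?_ ?_
  · rw [sq, ← Finset.card_product]
    refine Finset.card_le_card_of_injOn Prod.fst (fun z hz => ?_) fun z hz z' hz' h => ?_
    · exact Finset.mem_coe.2 (Finset.mem_product.2 (key z (Finset.mem_filter.1 hz).1).1.1)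
    · have eq : ∀ w ∈ Z.filter fun z => splitDist z.1.1 z.2.1 = 0, w.1 = w.2 := by
        intro w hw
        obtain ⟨h1, h2⟩ := Finset.mem_filter.1 hw
        obtain ⟨⟨⟨m1, m2⟩, m3, m4⟩, h3, -⟩ := key w h1
        exact Prod.ext (hA.eq_of_splitDist_eq_zero m1 m3 h2)
          (hA.eq_of_splitDist_eq_zero m2 m4 (h3.symm.trans h2))
      exact Prod.ext h ((eq z hz).symm.trans (h.trans (eq z' hz')))
  · rw [Finset.card_eq_sum_card_fiberwise (f := fun z => splitDist z.1.1 z.2.1)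
      (t := (splitDistSet A).erase 0) fun z hz => ?_]
    · refine Finset.sum_le_sum fun r _ => ?_
      rw [incid_eq_card]
      refine Finset.card_le_card_of_injOn (fun z => ((z.1.1, z.2.1), (z.1.2, z.2.2)))
        (fun z hz => ?_) fun z _ z' _ h => ?_
      · obtain ⟨h1, h2⟩ := Finset.mem_filter.1 hz
        obtain ⟨⟨⟨m1, m2⟩, m3, m4⟩, h3, h4⟩ := key z (Finset.mem_filter.1 h1).1
        refine Finset.mem_coe.2 (Finset.mem_filter.2 ⟨Finset.mem_product.2 ⟨?_, ?_⟩, h4⟩)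
        · exact Finset.mem_filter.2 ⟨Finset.mem_product.2 ⟨m1, m3⟩, h2⟩
        · exact Finset.mem_filter.2 ⟨Finset.mem_product.2 ⟨m2, m4⟩, h3.symm.trans h2⟩
      · simp only [Prod.mk.injEq] at h
        obtain ⟨⟨h1, h2⟩, h3, h4⟩ := h
        exact Prod.ext (Prod.ext h1 h3) (Prod.ext h2 h4)
    · obtain ⟨h1, h2⟩ := Finset.mem_filter.1 hz
      obtain ⟨⟨⟨m1, m2⟩, m3, m4⟩, -⟩ := key z h1
      exact Finset.mem_coe.2 (Finset.mem_erase.2 ⟨h2, splitDist_mem m1 m3⟩)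

theorem Anisotropic.card_pow_four_le (hA : Anisotropic A)
    (hD : 4 * (splitDistSet A).card ≤ A.card) :
    A.card ^ 4 ≤ 8 * (splitDistSet A).card ^ 2 * (A.card ^ 2 +
      ∑ r ∈ (splitDistSet A).erase 0, incid Axial (segments A r) (segments A r)) := by
  obtain ⟨U, h1, h2⟩ := hA.incid_equidistant_le
  have h3 := hA.card_common_bisector_le
  have h4 := card_cube_le A
  set B := ((A.offDiag ×ˢ A.offDiag).filter fun z => bisector z.1 = bisector z.2).card
  set a := A.card
  set D := (splitDistSet A).card
  refine le_trans ?_ (Nat.mul_le_mul_left _ h3)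
  rcases Nat.eq_zero_or_pos a with ha | ha
  · simp [ha]
  have h5 : a ^ 3 ≤ 2 * (D * U) := by
    have h6 : a ^ 3 ≤ D * (2 * a ^ 2 + U) := h4.trans (Nat.mul_le_mul_left _ (by omega))
    have h7 : 4 * D * a ^ 2 ≤ a * a ^ 2 := Nat.mul_le_mul_right _ hD
    nlinarith
  have h6 : (a ^ 3) ^ 2 ≤ (2 * (D * U)) ^ 2 := Nat.pow_le_pow_left h5 2
  have h7 : 4 * D ^ 2 * U ^ 2 ≤ 4 * D ^ 2 * (2 * a ^ 2 * B) := Nat.mul_le_mul_left _ h2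
  refine le_of_mul_le_mul_left ?_ (pow_pos ha 2)
  nlinarith

end Bisectors

section Exponents

open scoped Classical

variable {K : Type*} [Field K] {A : Finset (K × K)}

theorem Anisotropic.card_pow_four_mul_le {p : ℕ} [CharP K p] [Infinite K] (hA : Anisotropic A)
    {κ j : ℕ} (hD : 4 * (splitDistSet A).card ≤ A.card)
    (hk : 2 * (splitDistSet A).card ≤ κ ^ 2) (hj : 0 < j) (hp : 9 * j < p) :
    3 * j ^ 2 * A.card ^ 4 ≤ 8 * (splitDistSet A).card ^ 2 * (3 * j ^ 2 * A.card ^ 2 +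
      (A.card ^ 2 + 3 * j ^ 2 * (splitDistSet A).card) *
        ((54 * j + 2 * (splitDistSet A).card) *
          (3 * j ^ 2 + 2 * (splitDistSet A).card * A.card) +
            55 * ((9 * j) ^ 3 * (κ + 1)))) := by
  set X := (54 * j + 2 * (splitDistSet A).card) *
    (3 * j ^ 2 + 2 * (splitDistSet A).card * A.card) + 55 * ((9 * j) ^ 3 * (κ + 1)) with hX
  have h1 := hA.card_pow_four_le hD
  have h2 : ∑ r ∈ splitDistSet A, (segments A r).card = A.card ^ 2 := by
    rw [sq, ← Finset.card_product]
    exact (Finset.card_eq_sum_card_fiberwise fun q hq => Finset.mem_image_of_mem _ hq).symm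
  have h3 : 3 * j ^ 2 * ∑ r ∈ (splitDistSet A).erase 0, incid Axial (segments A r) (segments A r)
      ≤ (A.card ^ 2 + 3 * j ^ 2 * (splitDistSet A).card) * X := by
    calc _ ≤ ∑ r ∈ (splitDistSet A).erase 0, ((segments A r).card + 3 * j ^ 2) * X := by
          rw [Finset.mul_sum]
          refine Finset.sum_le_sum fun r hr => ?_
          calc _ ≤ 3 * j ^ 2 * (((segments A r).card / (3 * j ^ 2) + 1) * X) :=
                Nat.mul_le_mul_left _ (hA.card_axial_le (Finset.ne_of_mem_erase hr) hk hj hp)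
            _ = (3 * j ^ 2 * ((segments A r).card / (3 * j ^ 2)) + 3 * j ^ 2) * X := by ring
            _ ≤ _ := by
              gcongr
              exact Nat.mul_div_le _ _
      _ ≤ ∑ r ∈ splitDistSet A, ((segments A r).card + 3 * j ^ 2) * X :=
          Finset.sum_le_sum_of_subset (Finset.erase_subset _ _)
      _ = _ := by
          rw [← Finset.sum_mul, Finset.sum_add_distrib, h2, Finset.sum_const, smul_eq_mul,
            mul_comm (splitDistSet A).card]
  calc 3 * j ^ 2 * A.card ^ 4 ≤ 3 * j ^ 2 * _ := Nat.mul_le_mul_left _ h1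
    _ = 8 * (splitDistSet A).card ^ 2 * (3 * j ^ 2 * A.card ^ 2 + 3 * j ^ 2 *
        ∑ r ∈ (splitDistSet A).erase 0, incid Axial (segments A r) (segments A r)) := by ring
    _ ≤ _ := Nat.mul_le_mul_left _ (Nat.add_le_add_left h3 _)

theorem pow_three_le_of_axial_bound {y s j κ : ℝ} (hs : 1 ≤ s) (hsy : s ^ 3 ≤ y)
    (hj : y * s ≤ j) (hj' : j ≤ 2 * (y * s)) (hκ0 : 0 ≤ κ) (hκ : κ + 1 ≤ 4 * s ^ 2)
    (h : 3 * j ^ 2 * (y ^ 2) ^ 4 ≤ 8 * (s ^ 4) ^ 2 * (3 * j ^ 2 * (y ^ 2) ^ 2 +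
      ((y ^ 2) ^ 2 + 3 * j ^ 2 * s ^ 4) * ((54 * j + 2 * s ^ 4) *
        (3 * j ^ 2 + 2 * s ^ 4 * y ^ 2) + 55 * ((9 * j) ^ 3 * (κ + 1))))) :
    y ^ 3 ≤ 21600000 * s ^ 11 := by
  have hs3 : 1 ≤ s ^ 3 := one_le_pow₀ hs
  have hy : 1 ≤ y := hs3.trans hsy
  have hys : 1 ≤ y * s := one_le_mul_of_one_le_of_one_le hy hs
  have hj0 : 1 ≤ j := hys.trans hj
  have e1 : 54 * j + 2 * s ^ 4 ≤ 110 * (y * s) := by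
    have : s ^ 4 ≤ y * s := by
      rw [pow_succ]
      gcongr
    linarith
  have e2 : 3 * j ^ 2 + 2 * s ^ 4 * y ^ 2 ≤ 14 * (s ^ 4 * y ^ 2) := by
    have h1 : j ^ 2 ≤ (2 * (y * s)) ^ 2 := by gcongr
    have h2 : s ^ 2 * y ^ 2 ≤ s ^ 4 * y ^ 2 := by
      gcongr
      norm_num
    nlinarith
  have e3 : (9 * j) ^ 3 * (κ + 1) ≤ (9 * (2 * (y * s))) ^ 3 * (4 * s ^ 2) := by gcongr
  have e4 : (54 * j + 2 * s ^ 4) * (3 * j ^ 2 + 2 * s ^ 4 * y ^ 2) ≤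
      110 * (y * s) * (14 * (s ^ 4 * y ^ 2)) := by gcongr
  have e5 : (54 * j + 2 * s ^ 4) * (3 * j ^ 2 + 2 * s ^ 4 * y ^ 2) +
      55 * ((9 * j) ^ 3 * (κ + 1)) ≤ 1300000 * (y ^ 3 * s ^ 5) := by
    have : 0 ≤ y ^ 3 * s ^ 5 := by positivity
    nlinarith
  have e6 : (y ^ 2) ^ 2 ≤ j ^ 2 * (y ^ 2 / s ^ 2) := by
    have h1 : (y * s) ^ 2 ≤ j ^ 2 := by gcongr
    calc (y ^ 2) ^ 2 = (y * s) ^ 2 * (y ^ 2 / s ^ 2) := by field_simp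
      _ ≤ _ := by gcongr
  have e7 : s ^ 4 ≤ y ^ 2 / s ^ 2 := by
    rw [le_div_iff₀ (by positivity)]
    calc s ^ 4 * s ^ 2 = (s ^ 3) ^ 2 := by ring
      _ ≤ y ^ 2 := by gcongr
  have e8 : (y ^ 2) ^ 2 + 3 * j ^ 2 * s ^ 4 ≤ 3 * j ^ 2 * (2 * (y ^ 2 / s ^ 2)) := by
    have h1 : j ^ 2 * s ^ 4 ≤ j ^ 2 * (y ^ 2 / s ^ 2) := by gcongr
    have h2 : 0 ≤ j ^ 2 * (y ^ 2 / s ^ 2) := by positivity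
    linarith
  have e9 : (y ^ 2) ^ 2 ≤ y ^ 5 * s ^ 3 := by
    calc (y ^ 2) ^ 2 = y ^ 4 * 1 := by ring
      _ ≤ y ^ 4 * (y * s ^ 3) := by gcongr; exact one_le_mul_of_one_le_of_one_le hy hs3
      _ = _ := by ring
  have e10 : 3 * j ^ 2 * (y ^ 5 * y ^ 3) ≤ 3 * j ^ 2 * (y ^ 5 * (21600000 * s ^ 11)) := by
    calc 3 * j ^ 2 * (y ^ 5 * y ^ 3) = 3 * j ^ 2 * (y ^ 2) ^ 4 := by ring
      _ ≤ _ := h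
      _ ≤ 8 * (s ^ 4) ^ 2 * (3 * j ^ 2 * (y ^ 5 * s ^ 3) +
          3 * j ^ 2 * (2 * (y ^ 2 / s ^ 2)) * (1300000 * (y ^ 3 * s ^ 5))) := by gcongr
      _ = 3 * j ^ 2 * (y ^ 5 * (8 * 2600001 * s ^ 11)) := by field_simp; ring
      _ ≤ _ := by gcongr; norm_num
  exact le_of_mul_le_mul_left (le_of_mul_le_mul_left e10 (by positivity)) (by positivity)

/-- Anisotropic sets have at least `|A| ^ (6 / 11)` distances up to a constant. -/
theorem Anisotropic.rpow_card_le {p : ℕ} [CharP K p] [Infinite K] (hA : Anisotropic A)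
    (hp : 18 * (A.card : ℝ) ^ (7 / 11 : ℝ) < p) :
    (A.card : ℝ) ^ (6 / 11 : ℝ) ≤ 21600000 * ((splitDistSet A).card : ℝ) := by
  rcases A.eq_empty_or_nonempty with rfl | hne
  · simp
  set a : ℝ := (A.card : ℝ) with ha
  set D : ℝ := ((splitDistSet A).card : ℝ) with hDdef
  have ha1 : 1 ≤ a := Nat.one_le_cast.2 hne.card_pos
  have hD1 : 1 ≤ D := by
    obtain ⟨x, hx⟩ := hne
    exact Nat.one_le_cast.2 (Finset.card_pos.2 ⟨_, splitDist_mem hx hx⟩)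
  have ha0 : 0 ≤ a := zero_le_one.trans ha1
  have hD0 : 0 ≤ D := zero_le_one.trans hD1
  by_contra! hlt
  have hlt' : D < a ^ (6 / 11 : ℝ) := by linarith
  set y : ℝ := a ^ (1 / 2 : ℝ) with hy
  set s : ℝ := D ^ (1 / 4 : ℝ) with hs
  have hya : y ^ 2 = a := by
    rw [hy, ← Real.rpow_natCast, ← Real.rpow_mul ha0]
    norm_num
  have hsD : s ^ 4 = D := by
    rw [hs, ← Real.rpow_natCast, ← Real.rpow_mul hD0]
    norm_num
  have hs1 : 1 ≤ s := Real.one_le_rpow hD1 (by norm_num)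
  have hy1 : 1 ≤ y := Real.one_le_rpow ha1 (by norm_num)
  have hs' : s ≤ a ^ (3 / 22 : ℝ) := by
    calc s ≤ (a ^ (6 / 11 : ℝ)) ^ (1 / 4 : ℝ) := Real.rpow_le_rpow hD0 hlt'.le (by norm_num)
      _ = a ^ (3 / 22 : ℝ) := by
        rw [← Real.rpow_mul ha0]
        norm_num
  have hsy : s ^ 3 ≤ y := by
    calc s ^ 3 ≤ (a ^ (3 / 22 : ℝ)) ^ 3 := by gcongr
      _ = a ^ (9 / 22 : ℝ) := by
        rw [← Real.rpow_natCast, ← Real.rpow_mul ha0]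
        norm_num
      _ ≤ y := Real.rpow_le_rpow_of_exponent_le ha1 (by norm_num)
  have hys : y * s ≤ a ^ (7 / 11 : ℝ) := by
    calc y * s ≤ a ^ (1 / 2 : ℝ) * a ^ (3 / 22 : ℝ) := by gcongr
      _ = a ^ (7 / 11 : ℝ) := by
        rw [← Real.rpow_add (by linarith)]
        norm_num
  have hys1 : 1 ≤ y * s := one_le_mul_of_one_le_of_one_le hy1 hs1
  have hj' : (⌈y * s⌉₊ : ℝ) ≤ 2 * (y * s) := by
    have := Nat.ceil_lt_add_one (zero_le_one.trans hys1)
    linarith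
  have hs2 : 1 ≤ s ^ 2 := one_le_pow₀ hs1
  have hκ : (⌈2 * s ^ 2⌉₊ : ℝ) + 1 ≤ 4 * s ^ 2 := by
    have := Nat.ceil_lt_add_one (show (0 : ℝ) ≤ 2 * s ^ 2 by positivity)
    linarith
  have h4 : 4 * D ≤ a := by
    have h1 : a ^ (6 / 11 : ℝ) ≤ a := by
      simpa using Real.rpow_le_rpow_of_exponent_le ha1 (by norm_num : (6 / 11 : ℝ) ≤ 1)
    linarith
  have main := hA.card_pow_four_mul_le (p := p) (κ := ⌈2 * s ^ 2⌉₊) (j := ⌈y * s⌉₊)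
    (by rw [ha, hDdef] at h4; exact_mod_cast h4) ?_ (Nat.ceil_pos.2 (by linarith)) ?_
  · have main' : (_ : ℝ) ≤ _ := Nat.cast_le.2 main
    push_cast at main'
    rw [← ha, ← hDdef, ← hya, ← hsD] at main'
    have h3 := pow_three_le_of_axial_bound hs1 hsy (Nat.le_ceil _) hj' (Nat.cast_nonneg _) hκ main'
    refine hlt.not_ge ?_
    calc a ^ (6 / 11 : ℝ) = (y ^ 3) ^ (4 / 11 : ℝ) := by
          rw [hy, ← Real.rpow_natCast, ← Real.rpow_mul ha0, ← Real.rpow_mul ha0]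
          norm_num
      _ ≤ (21600000 * s ^ 11) ^ (4 / 11 : ℝ) := Real.rpow_le_rpow (by positivity) h3 (by norm_num)
      _ = 21600000 ^ (4 / 11 : ℝ) * D := by
          rw [Real.mul_rpow (by norm_num) (by positivity), hs, ← Real.rpow_natCast,
            ← Real.rpow_mul hD0, ← Real.rpow_mul hD0]
          norm_num
      _ ≤ 21600000 * D := by
          gcongr
          simpa using Real.rpow_le_rpow_of_exponent_le (x := 21600000) (by norm_num)
            (by norm_num : (4 / 11 : ℝ) ≤ 1)
  · have h1 : (2 * (splitDistSet A).card : ℝ) ≤ (⌈2 * s ^ 2⌉₊ : ℝ) ^ 2 := by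
      calc 2 * D = 2 * (s ^ 2) ^ 2 := by rw [← hsD]; ring
        _ ≤ (2 * s ^ 2) ^ 2 := by nlinarith
        _ ≤ _ := by gcongr; exact Nat.le_ceil _
    exact_mod_cast h1
  · have : (9 * ⌈y * s⌉₊ : ℝ) < p := by linarith
    exact_mod_cast this

end Exponents

section Transfer

variable {p : ℕ} [Fact p.Prime]

theorem eq_zero_of_sq_add_sq_eq_zero (hp : p % 4 = 3) {u v : ZMod p} (h : u ^ 2 + v ^ 2 = 0) :
    u = 0 ∧ v = 0 := by
  have hv : v = 0 := by
    by_contra hv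
    refine ZMod.exists_sq_eq_neg_one_iff.1 ⟨u / v, ?_⟩ hp
    field_simp
    linear_combination -h
  subst hv
  exact ⟨by simpa using h, rfl⟩

/-- Over the algebraic closure the distance becomes the split form. -/
theorem exists_anisotropic (hp : p % 4 = 3) (E : Finset (Pt p)) :
    ∃ A : Finset (AlgebraicClosure (ZMod p) × AlgebraicClosure (ZMod p)),
      Anisotropic A ∧ A.card = E.card ∧ (splitDistSet A).card = (distSet E).card := by
  classical
  obtain ⟨i, hi⟩ := IsAlgClosed.exists_pow_nat_eq (-1 : AlgebraicClosure (ZMod p)) two_pos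
  set f := algebraMap (ZMod p) (AlgebraicClosure (ZMod p)) with hf
  have f_inj : Function.Injective f := f.injective
  set φ : Pt p → AlgebraicClosure (ZMod p) × AlgebraicClosure (ZMod p) :=
    fun x => (f x.1 + i * f x.2, f x.1 - i * f x.2) with hφ
  have hdist : ∀ x y, splitDist (φ x) (φ y) = f (dist2 x y) := fun x y => by
    simp only [splitDist, dist2, hφ, map_add, map_sub, map_pow]
    linear_combination (-(f x.2 - f y.2) ^ 2) * hi
  have hdef : ∀ x y, splitDist (φ x) (φ y) = 0 → x = y := fun x y h => by
    rw [hdist, map_eq_zero_iff f f_inj] at h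
    obtain ⟨h1, h2⟩ := eq_zero_of_sq_add_sq_eq_zero hp h
    exact Prod.ext (sub_eq_zero.1 h1) (sub_eq_zero.1 h2)
  have hφ_inj : Function.Injective φ := fun x y h => hdef x y (by simp [splitDist, h])
  refine ⟨E.image φ, ⟨?_, ?_⟩, Finset.card_image_of_injective _ hφ_inj, ?_⟩
  · rw [Finset.coe_image]
    rintro _ ⟨x, -, rfl⟩ _ ⟨y, -, rfl⟩ h
    rw [hdef x y (by rw [splitDist, h, sub_self, zero_mul])]
  · rw [Finset.coe_image]
    rintro _ ⟨x, -, rfl⟩ _ ⟨y, -, rfl⟩ h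
    rw [hdef x y (by rw [splitDist, h, sub_self, mul_zero])]
  · rw [← Finset.card_image_of_injective (distSet E) f_inj]
    congr 1
    ext t
    simp only [splitDistSet, distSet, Finset.mem_image, Finset.mem_product]
    constructor
    · rintro ⟨⟨_, _⟩, ⟨⟨x, hx, rfl⟩, y, hy, rfl⟩, rfl⟩
      exact ⟨_, ⟨(x, y), ⟨hx, hy⟩, rfl⟩, (hdist x y).symm⟩
    · rintro ⟨_, ⟨⟨x, y⟩, ⟨hx, hy⟩, rfl⟩, rfl⟩
      exact ⟨(φ x, φ y), ⟨⟨x, hx, rfl⟩, y, hy, rfl⟩, hdist x y⟩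

theorem rpow_card_le_card_distSet (hp : p % 4 = 3) (E : Finset (Pt p))
    (hE : 18 * (E.card : ℝ) ^ (7 / 11 : ℝ) < p) :
    (E.card : ℝ) ^ (6 / 11 : ℝ) ≤ 21600000 * ((distSet E).card : ℝ) := by
  obtain ⟨A, h1, h2, h3⟩ := exists_anisotropic hp E
  have : CharP (AlgebraicClosure (ZMod p)) p :=
    charP_of_injective_algebraMap (algebraMap (ZMod p) _).injective p
  rw [← h2, ← h3]
  exact h1.rpow_card_le (p := p) (h2 ▸ hE)

end Transfer

/-- For every `ε > 0` there exist `c_ε > 0` and `c > 0` such that for every prime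
`p ≡ 3 (mod 4)` and every `E ⊆ 𝔽_p²` with `|E| ≤ c·p^{1558/1489}`, one has
`|Δ(E)| ≥ c_ε·p^{-ε}·|E|^{424/779}`. -/
theorem distance_new_exponent (ε : ℝ) (hε : 0 < ε) :
    ∃ cε c : ℝ, 0 < cε ∧ 0 < c ∧
      ∀ (p : ℕ) [Fact p.Prime], p % 4 = 3 →
        ∀ E : Finset (Pt p), (E.card : ℝ) ≤ c * (p : ℝ) ^ ((1558 : ℝ) / 1489) →
          cε * (p : ℝ) ^ (-ε) * (E.card : ℝ) ^ ((424 : ℝ) / 779) ≤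
            ((distSet E).card : ℝ) := by
  refine ⟨1 / 21600000, (1 / 19) ^ (11 / 7 : ℝ), by norm_num, by positivity, ?_⟩
  intro p _ hp E hE
  rcases E.eq_empty_or_nonempty with rfl | hne
  · simp
  have hE1 : (1 : ℝ) ≤ E.card := Nat.one_le_cast.2 hne.card_pos
  have hp1 : (1 : ℝ) ≤ p := Nat.one_le_cast.2 (Fact.out : p.Prime).one_lt.le
  have hp0 : (0 : ℝ) ≤ p := zero_le_one.trans hp1
  have h1 : (E.card : ℝ) ^ (7 / 11 : ℝ) ≤ 1 / 19 * p := by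
    calc (E.card : ℝ) ^ (7 / 11 : ℝ)
        ≤ ((1 / 19) ^ (11 / 7 : ℝ) * (p : ℝ) ^ ((1558 : ℝ) / 1489)) ^ (7 / 11 : ℝ) := by gcongr
      _ = 1 / 19 * (p : ℝ) ^ (10906 / 16379 : ℝ) := by
        rw [Real.mul_rpow (by positivity) (by positivity), ← Real.rpow_mul (by norm_num),
          ← Real.rpow_mul hp0]
        norm_num
      _ ≤ 1 / 19 * p := by
        gcongr
        simpa using Real.rpow_le_rpow_of_exponent_le hp1 (by norm_num : (10906 / 16379 : ℝ) ≤ 1)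
  have h2 := rpow_card_le_card_distSet hp E (by linarith)
  have h3 : (E.card : ℝ) ^ (424 / 779 : ℝ) ≤ (E.card : ℝ) ^ (6 / 11 : ℝ) :=
    Real.rpow_le_rpow_of_exponent_le hE1 (by norm_num)
  have h4 : (p : ℝ) ^ (-ε) ≤ 1 := Real.rpow_le_one_of_one_le_of_nonpos hp1 (by linarith)
  calc 1 / 21600000 * (p : ℝ) ^ (-ε) * (E.card : ℝ) ^ ((424 : ℝ) / 779)
      ≤ 1 / 21600000 * 1 * (21600000 * ((distSet E).card : ℝ)) := by
        gcongr
        exact h3.trans h2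
    _ = _ := by ring

end FpDist
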